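/- arXiv:1811.12702 — 2 statements merged into one kernel-verified Lean document; each statement's English description precedes it below -/
import Mathlib

section
/- Assume hypothesis (H1) and let p₀ > 0. Let W : closure(ℝⁿ ∖ C) → [0,∞) be a Lipschitz continuous p₀-OMRF. Then for any σ > 0 there exists a locally bounded feedback K : W⁻¹((0,σ]) → U that sample stabilizes and Euler stabilizes the system ẋ = f(x,u) to C with (p₀/2, W)-regulated cost for every initial point z ∈ W⁻¹((0,σ]). -/
open Filter Topology Metric MeasureTheory Bornology
open scoped RealInnerProductSpace ENNReal NNReal

noncomputable section

abbrev Euc (n : ℕ) : Type := EuclideanSpace ℝ (Fin n)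

/-- Distance to the target set. -/
def dC {n : ℕ} (C : Set (Euc n)) (y : Euc n) : ℝ := Metric.infDist y C

/-- The Hamiltonian `H(x, p₀, p) = inf_{u ∈ U} (⟪p, f(x,u)⟫ + p₀ l(x,u))`. -/
def Ham {n m : ℕ} (U : Set (Euc m)) (f : Euc n → Euc m → Euc n) (l : Euc n → Euc m → ℝ)
    (p0 : ℝ) (x p : Euc n) : ℝ :=
  sInf ((fun u => ⟪p, f x u⟫ + p0 * l x u) '' U)

/-- The Hamiltonian truncated to controls of norm at most `N`. -/
def HamN {n m : ℕ} (U : Set (Euc m)) (f : Euc n → Euc m → Euc n) (l : Euc n → Euc m → ℝ)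
    (N : ℝ) (p0 : ℝ) (x p : Euc n) : ℝ :=
  sInf ((fun u => ⟪p, f x u⟫ + p0 * l x u) '' (U ∩ Metric.closedBall 0 N))

/-- Set of limiting gradients `D*W(x)`. -/
def limitingGradients {n : ℕ} (W : Euc n → ℝ) (x : Euc n) : Set (Euc n) :=
  {w | ∃ xk : ℕ → Euc n, (∀ k, DifferentiableAt ℝ W (xk k) ∧ xk k ≠ x) ∧
    Tendsto xk atTop (𝓝 x) ∧ Tendsto (fun k => gradient W (xk k)) atTop (𝓝 w)}

/-- Proximal subdifferential `∂_P W(x)`. -/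
def proxSubdiff {n : ℕ} (W : Euc n → ℝ) (x : Euc n) : Set (Euc n) :=
  {p | ∃ σ > (0:ℝ), ∃ η > (0:ℝ), ∀ y, ‖y - x‖ ≤ η →
    ⟪p, y - x⟫ ≤ W y - W x + σ * ‖y - x‖ ^ 2}

/-- Limiting subdifferential `∂_L W(x)`. -/
def limitingSubdiff {n : ℕ} (W : Euc n → ℝ) (x : Euc n) : Set (Euc n) :=
  {p | ∃ (xk : ℕ → Euc n) (pk : ℕ → Euc n), (∀ k, pk k ∈ proxSubdiff W (xk k)) ∧
    Tendsto xk atTop (𝓝 x) ∧ Tendsto pk atTop (𝓝 p)}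

/-- `W` is positive definite on `ℝⁿ ∖ C`. -/
def PosDefOn {n : ℕ} (C : Set (Euc n)) (W : Euc n → ℝ) : Prop :=
  (∀ x, x ∉ C → 0 < W x) ∧ ∀ x ∈ frontier C, W x = 0

/-- `W` is proper on `ℝⁿ ∖ C`: preimages (within the closure of the complement of the
target) of compact subsets of `[0,∞)` are compact. -/
def ProperOn {n : ℕ} (C : Set (Euc n)) (W : Euc n → ℝ) : Prop :=
  ∀ Kc : Set ℝ, IsCompact Kc → Kc ⊆ Set.Ici 0 → IsCompact (closure Cᶜ ∩ W ⁻¹' Kc)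

/-- `W` is locally semiconcave on `ℝⁿ ∖ C`. -/
def LocSemiconcaveOn {n : ℕ} (C : Set (Euc n)) (W : Euc n → ℝ) : Prop :=
  ∀ S : Set (Euc n), IsCompact S → S ⊆ Cᶜ → ∃ ρ > (0:ℝ),
    ∀ x y : Euc n, segment ℝ x y ⊆ S →
      W x + W y - 2 * W (midpoint ℝ x y) ≤ ρ * ‖x - y‖ ^ 2

/-- `W` is locally Lipschitz continuous on the set `s`. -/
def LocLipschitzOn {n : ℕ} (s : Set (Euc n)) (W : Euc n → ℝ) : Prop :=
  ∀ x ∈ s, ∃ (K : ℝ≥0) (t : Set (Euc n)), t ∈ nhdsWithin x s ∧ LipschitzOnWith K W t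

/-- `γ : (0,∞) → (0,∞)` is a continuous, strictly increasing rate function. -/
def RateFun (γ : ℝ → ℝ) : Prop :=
  ContinuousOn γ (Set.Ioi 0) ∧ StrictMonoOn γ (Set.Ioi 0) ∧ ∀ r, 0 < r → 0 < γ r

/-- `W` is a `p₀`-Minimum Restraint Function with rate `γ`. -/
def IsMRF {n m : ℕ} (C : Set (Euc n)) (U : Set (Euc m)) (f : Euc n → Euc m → Euc n)
    (l : Euc n → Euc m → ℝ) (p0 : ℝ) (W : Euc n → ℝ) (γ : ℝ → ℝ) : Prop :=
  ContinuousOn W (closure Cᶜ) ∧ (∀ x ∈ closure Cᶜ, 0 ≤ W x) ∧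
  LocSemiconcaveOn C W ∧ PosDefOn C W ∧ ProperOn C W ∧ RateFun γ ∧
  ∀ x, x ∉ C → ∀ p ∈ limitingGradients W x, Ham U f l p0 x p ≤ -γ (W x)

/-- `W` is a `p₀`-OMRF (original Minimum Restraint Function of Motta-Rampazzo). -/
def IsOMRF {n m : ℕ} (C : Set (Euc n)) (U : Set (Euc m)) (f : Euc n → Euc m → Euc n)
    (l : Euc n → Euc m → ℝ) (p0 : ℝ) (W : Euc n → ℝ) : Prop :=
  ContinuousOn W (closure Cᶜ) ∧ (∀ x ∈ closure Cᶜ, 0 ≤ W x) ∧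
  LocSemiconcaveOn C W ∧ PosDefOn C W ∧ ProperOn C W ∧
  ∀ x, x ∉ C → ∀ p ∈ limitingGradients W x, Ham U f l p0 x p < 0

/-- Hypothesis (H0). -/
def HypH0 {n m : ℕ} (C : Set (Euc n)) (U : Set (Euc m)) (f : Euc n → Euc m → Euc n)
    (l : Euc n → Euc m → ℝ) : Prop :=
  IsClosed C ∧ IsCompact (frontier C) ∧ IsClosed U ∧
  (∀ x u, u ∈ U → 0 ≤ l x u) ∧
  (∀ Kc : Set (Euc n), IsCompact Kc → Kc ⊆ Cᶜ →
    UniformContinuousOn (fun q : Euc n × Euc m => f q.1 q.2) (Kc ×ˢ U) ∧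
    UniformContinuousOn (fun q : Euc n × Euc m => l q.1 q.2) (Kc ×ˢ U)) ∧
  (∀ R : ℝ, 0 < R → ∃ M : ℝ, 0 < M ∧ ∀ x u, dC C x ≤ R → x ∉ C → u ∈ U →
    ‖f x u‖ ≤ M ∧ l x u ≤ M)

/-- Hypothesis (H1). -/
def HypH1 {n m : ℕ} (C : Set (Euc n)) (U : Set (Euc m)) (f : Euc n → Euc m → Euc n)
    (l : Euc n → Euc m → ℝ) : Prop :=
  IsClosed C ∧ IsCompact (frontier C) ∧ IsClosed U ∧
  (∀ x u, u ∈ U → 0 ≤ l x u) ∧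
  ContinuousOn (fun q : Euc n × Euc m => f q.1 q.2) (closure Cᶜ ×ˢ U) ∧
  ContinuousOn (fun q : Euc n × Euc m => l q.1 q.2) (closure Cᶜ ×ˢ U) ∧
  (∀ Kc : Set (Euc n), IsCompact Kc → Kc ⊆ closure Cᶜ →
    ∃ Mf Ml Lf Ll : ℝ, 0 < Mf ∧ 0 < Ml ∧ 0 < Lf ∧ 0 < Ll ∧
      (∀ x ∈ Kc, ∀ u ∈ U, ‖f x u‖ ≤ Mf ∧ l x u ≤ Ml) ∧
      (∀ x₁ ∈ Kc, ∀ x₂ ∈ Kc, ∀ u ∈ U,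
        ‖f x₁ u - f x₂ u‖ ≤ Lf * ‖x₁ - x₂‖ ∧ |l x₁ u - l x₂ u| ≤ Ll * ‖x₁ - x₂‖))

/-- A partition of `[0,∞)`. -/
structure TimePartition where
  t : ℕ → ℝ
  zero : t 0 = 0
  mono : StrictMono t
  unbounded : Tendsto t atTop atTop

/-- A class-`KL` comparison function. -/
structure IsKL (β : ℝ → ℝ → ℝ) : Prop where
  nonneg : ∀ r t, 0 ≤ r → 0 ≤ t → 0 ≤ β r t
  cont : ∀ t, 0 ≤ t → ContinuousOn (fun r => β r t) (Set.Ici 0)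
  strictMono : ∀ t, 0 ≤ t → StrictMonoOn (fun r => β r t) (Set.Ici 0)
  zero : ∀ t, 0 ≤ t → β 0 t = 0
  anti : ∀ r, 0 ≤ r → AntitoneOn (fun t => β r t) (Set.Ici 0)
  tendsto : ∀ r, 0 ≤ r → Tendsto (fun t => β r t) atTop (𝓝 0)

/-- `(x,u)` is a `π`-sampling trajectory-control pair from `z` associated with the
feedback `K`, with exit time `T`; trajectories reaching the target at a finite exit
time are extended to `[0,∞)` by their limit value. -/
structure IsSamplingSol {n m : ℕ} (C : Set (Euc n)) (U : Set (Euc m))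
    (f : Euc n → Euc m → Euc n) (K : Euc n → Euc m) (π : TimePartition) (z : Euc n)
    (x : ℝ → Euc n) (u : ℝ → Euc m) (T : ℝ≥0∞) : Prop where
  pos : 0 < T
  init : x 0 = z
  cont : ContinuousOn x (Set.Ici 0)
  ctrl : ∀ j : ℕ, ∀ t ∈ Set.Ico (π.t j) (π.t (j+1)), u t = K (x (π.t j))
  outside : ∀ t : ℝ, 0 ≤ t → ENNReal.ofReal t < T → x t ∉ C
  deriv : ∀ t : ℝ, 0 < t → ENNReal.ofReal t < T → (∀ j, t ≠ π.t j) →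
    HasDerivAt x (f (x t) (u t)) t
  exit : ∀ tr : ℝ, 0 ≤ tr → T = ENNReal.ofReal tr →
    dC C (x tr) = 0 ∧ ∀ s, tr ≤ s → x s = x tr

/-- The time `T̄ᵣ` after which the trajectory remains in the `r`-neighbourhood
of the target. -/
def Tbar {n : ℕ} (C : Set (Euc n)) (x : ℝ → Euc n) (r : ℝ) : ℝ :=
  sInf {t : ℝ | 0 < t ∧ ∀ τ, t ≤ τ → dC C (x τ) ≤ r}

/-- `K` sample stabilizes the system to `C` with `(q,W)`-regulated cost, for initial
points in `Z`. -/
def SampleStabOn {n m : ℕ} (C : Set (Euc n)) (U : Set (Euc m))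
    (f : Euc n → Euc m → Euc n) (l : Euc n → Euc m → ℝ) (K : Euc n → Euc m)
    (Z : Set (Euc n)) (q : ℝ) (W : Euc n → ℝ) : Prop :=
  ∃ β : ℝ → ℝ → ℝ, IsKL β ∧
    ∀ r R : ℝ, 0 < r → r < R → ∃ δ > (0:ℝ),
      ∀ π : TimePartition, (∀ j, π.t (j+1) - π.t j ≤ δ) →
      ∀ z ∈ Z, dC C z ≤ R →
      ∀ x u T, IsSamplingSol C U f K π z x u T →
        (∀ t, 0 ≤ t → dC C (x t) ≤ max (β R t) r) ∧
        (∫ τ in (0:ℝ)..(Tbar C x r), l (x τ) (u τ)) ≤ W z / q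

/-- `X` is an Euler trajectory of the system from `z` associated with `K`. -/
def IsEulerTraj {n m : ℕ} (C : Set (Euc n)) (U : Set (Euc m))
    (f : Euc n → Euc m → Euc n) (K : Euc n → Euc m) (z : Euc n) (X : ℝ → Euc n) : Prop :=
  ∃ (π : ℕ → TimePartition) (x : ℕ → ℝ → Euc n) (u : ℕ → ℝ → Euc m)
    (T : ℕ → ℝ≥0∞) (δ : ℕ → ℝ),
    Tendsto δ atTop (𝓝 0) ∧ (∀ i j, (π i).t (j+1) - (π i).t j ≤ δ i) ∧
    (∀ i, IsSamplingSol C U f K (π i) z (x i) (u i) (T i)) ∧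
    TendstoLocallyUniformlyOn x X atTop (Set.Ici 0)

/-- `(X, X⁰)` is an Euler trajectory-cost pair from `z` associated with `K`. -/
def IsEulerPair {n m : ℕ} (C : Set (Euc n)) (U : Set (Euc m))
    (f : Euc n → Euc m → Euc n) (l : Euc n → Euc m → ℝ) (K : Euc n → Euc m)
    (z : Euc n) (X : ℝ → Euc n) (X0 : ℝ → ℝ) : Prop :=
  ∃ (π : ℕ → TimePartition) (x : ℕ → ℝ → Euc n) (u : ℕ → ℝ → Euc m)
    (T : ℕ → ℝ≥0∞) (δ : ℕ → ℝ),
    Tendsto δ atTop (𝓝 0) ∧ (∀ i j, (π i).t (j+1) - (π i).t j ≤ δ i) ∧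
    (∀ i, IsSamplingSol C U f K (π i) z (x i) (u i) (T i)) ∧
    TendstoLocallyUniformlyOn x X atTop (Set.Ici 0) ∧
    TendstoLocallyUniformlyOn (fun i s => ∫ τ in (0:ℝ)..s, l (x i τ) (u i τ)) X0
      atTop (Set.Ici 0)

/-- The filter of approach to `T` from the left (`atTop` when `T = ∞`). -/
def leftFilter (T : ℝ≥0∞) : Filter ℝ :=
  if T = ⊤ then Filter.atTop else nhdsWithin T.toReal (Set.Iio T.toReal)

/-- The exit time `T_X` of a (Euler) trajectory `X`. -/
def exitTimeInf {n : ℕ} (C : Set (Euc n)) (X : ℝ → Euc n) : ℝ≥0∞ :=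
  sInf {τ : ℝ≥0∞ | 0 < τ ∧ (∀ t : ℝ, 0 ≤ t → ENNReal.ofReal t < τ → X t ∉ C) ∧
    Tendsto (fun t => dC C (X t)) (leftFilter τ) (𝓝 0)}

/-- `K` Euler stabilizes the system to `C` with `(q,W)`-regulated cost, for initial
points in `Z`. -/
def EulerStabOn {n m : ℕ} (C : Set (Euc n)) (U : Set (Euc m))
    (f : Euc n → Euc m → Euc n) (l : Euc n → Euc m → ℝ) (K : Euc n → Euc m)
    (Z : Set (Euc n)) (q : ℝ) (W : Euc n → ℝ) : Prop :=
  ∃ β : ℝ → ℝ → ℝ, IsKL β ∧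
    ∀ z ∈ Z,
      (∀ X, IsEulerTraj C U f K z X → ∀ t, 0 ≤ t → dC C (X t) ≤ β (dC C z) t) ∧
      (∀ X X0, IsEulerPair C U f l K z X X0 →
        ∀ t, 0 ≤ t → ENNReal.ofReal t < exitTimeInf C X → X0 t ≤ W z / q)

/-- A locally bounded feedback taking values in the control set. -/
def IsFeedback {n m : ℕ} (C : Set (Euc n)) (U : Set (Euc m)) (K : Euc n → Euc m) : Prop :=
  (∀ x, x ∉ C → K x ∈ U) ∧
  ∀ x, x ∉ C → ∃ V ∈ 𝓝 x, Bornology.IsBounded (K '' (V \ C))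

/-- `K` is a `W`-feedback: for the selection `psel x ∈ D*W(x)`, `K x` minimizes
`u ↦ ⟪psel x, f(x,u)⟫ + p₀ l(x,u)` over `U ∩ B(0, N(W x))`. -/
def IsWFeedback {n m : ℕ} (C : Set (Euc n)) (U : Set (Euc m))
    (f : Euc n → Euc m → Euc n) (l : Euc n → Euc m → ℝ) (p0 : ℝ) (W : Euc n → ℝ)
    (N : ℝ → ℝ) (psel : Euc n → Euc n) (K : Euc n → Euc m) : Prop :=
  ∀ x, x ∉ C →
    K x ∈ U ∩ Metric.closedBall 0 (N (W x)) ∧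
    ∀ v ∈ U ∩ Metric.closedBall 0 (N (W x)),
      ⟪psel x, f x (K x)⟫ + p0 * l x (K x) ≤ ⟪psel x, f x v⟫ + p0 * l x v

/-- `(x,u)` is an admissible trajectory-control pair from `z` with exit time `T`. -/
structure IsAdmissiblePair {n m : ℕ} (C : Set (Euc n)) (U : Set (Euc m))
    (f : Euc n → Euc m → Euc n) (z : Euc n) (x : ℝ → Euc n) (u : ℝ → Euc m)
    (T : ℝ≥0∞) : Prop where
  pos : 0 < T
  init : x 0 = z
  outside : ∀ t : ℝ, 0 ≤ t → ENNReal.ofReal t < T → x t ∉ C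
  ctrlmem : ∀ t : ℝ, 0 ≤ t → ENNReal.ofReal t < T → u t ∈ U
  meas : AEStronglyMeasurable u volume
  locbdd : ∀ b : ℝ, 0 ≤ b → ENNReal.ofReal b < T →
    ∃ M : ℝ, ∀ᵐ s ∂volume, s ∈ Set.Icc (0:ℝ) b → ‖u s‖ ≤ M
  sol : ∀ t : ℝ, 0 ≤ t → ENNReal.ofReal t < T →
    x t = z + ∫ s in (0:ℝ)..t, f (x s) (u s)

end

/-- Uniform strict decrease with bounded controls over a compact shell. -/
theorem aux_margin {n m : ℕ} (C : Set (Euc n)) (U : Set (Euc m))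
    (f : Euc n → Euc m → Euc n) (l : Euc n → Euc m → ℝ)
    (p0 : ℝ) (W : Euc n → ℝ) (hH1 : HypH1 C U f l)
    (hdec : ∀ x, x ∉ C → ∀ p ∈ limitingSubdiff W x, Ham U f l p0 x p < 0)
    (S : Set (Euc n)) (hS : IsCompact S) (hSC : S ⊆ Cᶜ) (P : ℝ) :
    ∃ N : ℝ, 0 < N ∧ ∀ y ∈ S, ∀ p ∈ proxSubdiff W y, ‖p‖ ≤ P →
      ∃ u ∈ U, ‖u‖ ≤ N ∧ ⟪p, f y u⟫ + p0 * l y u ≤ -(1 / N) := by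
  obtain ⟨hC, -, -, -, hfc, hlc, -⟩ := hH1
  by_contra hcon
  push Not at hcon
  have h1 : ∀ k : ℕ, ∃ y ∈ S, ∃ p ∈ proxSubdiff W y, ‖p‖ ≤ P ∧
      ∀ u ∈ U, ‖u‖ ≤ (k : ℝ) + 1 → -(1 / ((k : ℝ) + 1)) < ⟪p, f y u⟫ + p0 * l y u :=
    fun k => hcon ((k : ℝ) + 1) (by positivity)
  choose y hyS p hp hpP hu using h1
  obtain ⟨y0, hy0, φ, hφ, hyt⟩ := hS.tendsto_subseq hyS
  obtain ⟨pp, -, ψ, hψ, hpt⟩ := (isCompact_closedBall (0 : Euc n) P).tendsto_subseq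
    (x := p ∘ φ) (fun k => by simpa using hpP (φ k))
  have hyt2 : Tendsto (fun k => y (φ (ψ k))) atTop (𝓝 y0) := hyt.comp hψ.tendsto_atTop
  have hpt2 : Tendsto (fun k => p (φ (ψ k))) atTop (𝓝 pp) := hpt
  have hlim : pp ∈ limitingSubdiff W y0 :=
    ⟨fun k => y (φ (ψ k)), fun k => p (φ (ψ k)), fun k => hp _, hyt2, hpt2⟩
  have hH := hdec y0 (hSC hy0) pp hlim
  obtain ⟨u, huU, huneg⟩ : ∃ u ∈ U, ⟪pp, f y0 u⟫ + p0 * l y0 u < 0 := by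
    by_contra hno
    push Not at hno
    refine absurd hH (not_lt.mpr ?_)
    apply Real.sInf_nonneg
    rintro _ ⟨u, hu, rfl⟩
    exact hno u hu
  have hmem : ∀ k, (y (φ (ψ k)), u) ∈ closure Cᶜ ×ˢ U :=
    fun k => ⟨subset_closure (hSC (hyS _)), huU⟩
  have hpair : Tendsto (fun k => (y (φ (ψ k)), u)) atTop (𝓝[closure Cᶜ ×ˢ U] (y0, u)) :=
    tendsto_nhdsWithin_iff.2 ⟨hyt2.prodMk_nhds tendsto_const_nhds, Eventually.of_forall hmem⟩
  have hft := (hfc (y0, u) ⟨subset_closure (hSC hy0), huU⟩).tendsto.comp hpair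
  have hlt := (hlc (y0, u) ⟨subset_closure (hSC hy0), huU⟩).tendsto.comp hpair
  have htot : Tendsto (fun k => ⟪p (φ (ψ k)), f (y (φ (ψ k))) u⟫ + p0 * l (y (φ (ψ k))) u)
      atTop (𝓝 (⟪pp, f y0 u⟫ + p0 * l y0 u)) :=
    (hpt2.inner hft).add (hlt.const_mul p0)
  have hidx : Tendsto (fun k => φ (ψ k)) atTop atTop := hφ.tendsto_atTop.comp hψ.tendsto_atTop
  have hzero : Tendsto (fun k => -(1 / (((φ (ψ k) : ℕ) : ℝ) + 1))) atTop (𝓝 (-0)) :=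
    (tendsto_one_div_add_atTop_nhds_zero_nat.comp hidx).neg
  have hge : -0 ≤ ⟪pp, f y0 u⟫ + p0 * l y0 u := by
    refine le_of_tendsto_of_tendsto hzero htot ?_
    have hN := hidx.eventually (eventually_ge_atTop ⌈‖u‖⌉₊)
    filter_upwards [hN] with k hk
    refine (hu _ u huU ?_).le
    have : ‖u‖ ≤ (⌈‖u‖⌉₊ : ℝ) := Nat.le_ceil _
    have h2 : (⌈‖u‖⌉₊ : ℝ) ≤ ((φ (ψ k) : ℕ) : ℝ) := by exact_mod_cast hk
    linarith
  linarith

/-- Mean value inequality with derivative information only on the open interval. -/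
theorem aux_mvt {n : ℕ} (g g' : ℝ → Euc n) (a b c : ℝ) (hab : a ≤ b)
    (hg : ContinuousOn g (Set.Icc a b)) (hd : ∀ t ∈ Set.Ioo a b, HasDerivAt g (g' t) t)
    (hc : ∀ t ∈ Set.Ioo a b, ‖g' t‖ ≤ c) : ‖g b - g a‖ ≤ c * (b - a) := by
  rcases hab.eq_or_lt with rfl | hlt
  · simp
  set v := g b - g a with hv
  obtain ⟨t, ht, hts⟩ := exists_hasDerivAt_eq_slope (fun t => ⟪v, g t⟫) (fun t => ⟪v, g' t⟫) hlt
    (continuousOn_const.inner hg) (fun t ht => by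
      simpa using (hasDerivAt_const t v).inner ℝ (hd t ht))
  rw [eq_div_iff (by linarith)] at hts
  have h1 : ⟪v, g b⟫ - ⟪v, g a⟫ = ‖v‖ ^ 2 := by
    rw [← inner_sub_right, ← hv, real_inner_self_eq_norm_sq]
  have h2 : ⟪v, g' t⟫ ≤ ‖v‖ * c :=
    (real_inner_le_norm _ _).trans (mul_le_mul_of_nonneg_left (hc t ht) (norm_nonneg _))
  have h3 : ‖v‖ * ‖v‖ ≤ ‖v‖ * (c * (b - a)) := by
    have := mul_le_mul_of_nonneg_right h2 (sub_nonneg.2 hab)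
    nlinarith
  rcases (norm_nonneg v).eq_or_lt with h0 | h0
  · rw [← h0]
    have : 0 ≤ c := (norm_nonneg _).trans (hc t ht)
    exact mul_nonneg this (sub_nonneg.2 hab)
  · exact le_of_mul_le_mul_left h3 h0

/-- The family of quadratic upper models whose infimum is the Lyapunov function. -/
noncomputable def auxG {n : ℕ} (W : Euc n → ℝ) (S : ℝ) (lam : ℕ → ℝ) (i : ℕ) (y x : Euc n) : ℝ :=
  (2 - (1 / 2 : ℝ) ^ i) * (W y + lam i * ‖x - y‖ ^ 2) + S * ((1 / 2 : ℝ) ^ i) ^ 2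

theorem auxG_lower {n : ℕ} (W : Euc n → ℝ) (S L : ℝ) (lam : ℕ → ℝ)
    (hlam0 : ∀ i, 0 < lam i)
    (hlam : ∀ i, 2 * L ^ 2 ≤ S * ((1 / 2 : ℝ) ^ i) ^ 2 * lam i) (i : ℕ) (y x : Euc n)
    (hL : W x - W y ≤ L * ‖x - y‖) :
    (2 - (1 / 2 : ℝ) ^ i) * W x + 3 / 4 * (S * ((1 / 2 : ℝ) ^ i) ^ 2) ≤ auxG W S lam i y x := by
  unfold auxG
  have hq0 : (0 : ℝ) < (1 / 2 : ℝ) ^ i := by positivity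
  have hq1 : (1 / 2 : ℝ) ^ i ≤ 1 := pow_le_one₀ (by norm_num) (by norm_num)
  have hl := hlam i
  have hl0 := hlam0 i
  generalize (1 / 2 : ℝ) ^ i = q at *
  generalize lam i = lm at *
  generalize ‖x - y‖ = d at *
  -- `W y + lm d² ≥ W x - S q² / 8`
  have key : W x - S * q ^ 2 / 8 ≤ W y + lm * d ^ 2 := by
    have h1 : 0 ≤ lm * (S * q ^ 2 / 8 - L * d + lm * d ^ 2) := by
      nlinarith [sq_nonneg (2 * lm * d - L)]
    have h2 := nonneg_of_mul_nonneg_right h1 hl0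
    linarith
  have hSq : 0 ≤ S * q ^ 2 := by
    have : 0 ≤ S * q ^ 2 * lm := le_trans (by positivity) hl
    exact nonneg_of_mul_nonneg_left this hl0
  nlinarith [mul_le_mul_of_nonneg_left key (by linarith : (0:ℝ) ≤ 2 - q)]

theorem aux_attain {n : ℕ} (W : Euc n → ℝ) (S L : ℝ) (hS : 0 < S) (lam : ℕ → ℝ)
    (Q : Set (Euc n)) (hQ : IsCompact Q) (hWQ : ContinuousOn W Q)
    (hlam0 : ∀ i, 0 < lam i)
    (hlam : ∀ i, 2 * L ^ 2 ≤ S * ((1 / 2 : ℝ) ^ i) ^ 2 * lam i) (x : Euc n) (hx : x ∈ Q)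
    (hL : ∀ y ∈ Q, W x - W y ≤ L * ‖x - y‖) (hW0 : 0 < W x) (hWS : W x ≤ S) :
    ∃ i, ∃ y ∈ Q, (∀ j, ∀ y' ∈ Q, auxG W S lam i y x ≤ auxG W S lam j y' x) ∧
      auxG W S lam i y x ≤ 2 * W x - (W x) ^ 2 / (8 * S) := by
  have hmin : ∀ j, ∃ y ∈ Q, ∀ y' ∈ Q, auxG W S lam j y x ≤ auxG W S lam j y' x := by
    intro j
    have hc : ContinuousOn (fun y => auxG W S lam j y x) Q := by
      unfold auxG
      fun_prop
    obtain ⟨y, hy, hm⟩ := hQ.exists_isMinOn ⟨x, hx⟩ hc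
    exact ⟨y, hy, fun y' hy' => hm hy'⟩
  choose y hyQ hym using hmin
  -- a good index
  obtain ⟨k, hk1, hk2⟩ := exists_nat_pow_near_of_lt_one (x := W x / (2 * S)) (y := (1 / 2 : ℝ))
    (by positivity) (by rw [div_le_one (by positivity)]; linarith) (by norm_num) (by norm_num)
  have hstar : auxG W S lam (k + 1) (y (k + 1)) x ≤ 2 * W x - (W x) ^ 2 / (8 * S) := by
    refine (hym (k + 1) x hx).trans ?_
    unfold auxG
    have h2 : (1 / 2 : ℝ) ^ k = 2 * (1 / 2 : ℝ) ^ (k + 1) := by rw [pow_succ]; ring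
    rw [h2] at hk2
    generalize (1 / 2 : ℝ) ^ (k + 1) = q at *
    rw [lt_div_iff₀ (by positivity)] at hk1
    rw [div_le_iff₀ (by positivity)] at hk2
    have hq : 0 < q := by
      by_contra hq
      push Not at hq
      nlinarith
    simp only [sub_self, norm_zero]
    have h3 : S * q ^ 2 ≤ q * W x / 2 := by nlinarith
    have h4 : (W x) ^ 2 / (8 * S) ≤ q * W x / 2 := by
      rw [div_le_iff₀ (by positivity)]
      nlinarith
    nlinarith
  obtain ⟨I, hI⟩ := exists_pow_lt_of_lt_one (x := W x / (8 * S)) (y := (1 / 2 : ℝ))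
    (by positivity) (by norm_num)
  obtain ⟨i, hi, himin⟩ := Finset.exists_min_image (Finset.range (I + k + 2))
    (fun j => auxG W S lam j (y j) x) ⟨0, by simp⟩
  have hile : auxG W S lam i (y i) x ≤ 2 * W x - (W x) ^ 2 / (8 * S) :=
    (himin (k + 1) (by simp)).trans hstar
  refine ⟨i, y i, hyQ i, ?_, hile⟩
  intro j y' hy'
  by_cases hj : j < I + k + 2
  · exact (himin j (by simpa using hj)).trans (hym j y' hy')
  · refine hile.trans ?_
    refine le_trans ?_ (auxG_lower W S L lam hlam0 hlam j y' x (hL y' hy'))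
    have hjI : (1 / 2 : ℝ) ^ j ≤ (1 / 2 : ℝ) ^ I :=
      pow_le_pow_of_le_one (by norm_num) (by norm_num) (by omega)
    have hlt : (1 / 2 : ℝ) ^ j ≤ W x / (8 * S) := hjI.trans hI.le
    have hmul := mul_le_mul_of_nonneg_right hlt hW0.le
    have he : W x / (8 * S) * W x = (W x) ^ 2 / (8 * S) := by ring
    rw [he] at hmul
    have : 0 ≤ 3 / 4 * (S * ((1 / 2 : ℝ) ^ j) ^ 2) := by positivity
    linarith

set_option maxHeartbeats 2000000 in
/-- Existence of the Lyapunov function and the feedback. -/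
theorem aux_lyap {n m : ℕ} (C : Set (Euc n)) (U : Set (Euc m))
    (f : Euc n → Euc m → Euc n) (l : Euc n → Euc m → ℝ)
    (p0 : ℝ) (W : Euc n → ℝ) (hH1 : HypH1 C U f l) (hp0 : 0 < p0)
    (hWc : ContinuousOn W (closure Cᶜ)) (hWpd : PosDefOn C W) (hWpr : ProperOn C W)
    (hdec : ∀ x, x ∉ C → ∀ p ∈ limitingSubdiff W x, Ham U f l p0 x p < 0)
    (S L Lf Ll : ℝ) (hS : 0 < S) (hL0 : 0 < L) (hLf0 : 0 < Lf) (hLl0 : 0 < Ll)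
    (Q : Set (Euc n)) (hQdef : Q = closure Cᶜ ∩ W ⁻¹' Set.Icc 0 S)
    (hL : ∀ x ∈ Q, ∀ y ∈ Q, W x - W y ≤ L * ‖x - y‖)
    (hLf : ∀ x ∈ Q, ∀ y ∈ Q, ∀ u ∈ U, ‖f x u - f y u‖ ≤ Lf * ‖x - y‖)
    (hLl : ∀ x ∈ Q, ∀ y ∈ Q, ∀ u ∈ U, |l x u - l y u| ≤ Ll * ‖x - y‖) :
    ∃ (V : Euc n → ℝ) (K : Euc n → Euc m), (∀ x, 0 ≤ V x) ∧
      (∀ x ∈ Q, x ∉ C → W x ≤ V x ∧ V x ≤ 2 * W x) ∧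
      ∀ η : ℝ, 0 < η → ∃ N : ℝ, 0 < N ∧ ∃ Λ : ℝ, 0 ≤ Λ ∧
        ∀ x ∈ Q, η ≤ W x → W x < S → K x ∈ U ∧ ‖K x‖ ≤ N ∧
          ∃ p : Euc n, ‖p‖ ≤ 4 * L ∧ ⟪p, f x (K x)⟫ + p0 * l x (K x) ≤ -(1 / (2 * N)) ∧
            ∀ x', V x' ≤ V x + ⟪p, x' - x⟫ + Λ * ‖x' - x‖ ^ 2 := by
  have hC : IsClosed C := hH1.1
  have hQ : IsCompact Q := by
    rw [hQdef]; exact hWpr _ isCompact_Icc (fun t ht => ht.1)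
  have hQcl : Q ⊆ closure Cᶜ := by rw [hQdef]; exact Set.inter_subset_left
  have hQW : ∀ x ∈ Q, 0 ≤ W x ∧ W x ≤ S := by
    intro x hx; rw [hQdef] at hx; exact hx.2
  have hWQ : ContinuousOn W Q := hWc.mono hQcl
  have hnotC : ∀ x ∈ closure Cᶜ, 0 < W x → x ∉ C := by
    intro x hx hpos hxC
    have : x ∈ frontier C := by
      rw [frontier_eq_closure_inter_closure]
      exact ⟨subset_closure hxC, hx⟩
    have := hWpd.2 x this
    linarith
  -- margins on shells
  have hmarg : ∀ i : ℕ, ∃ N : ℝ, 0 < N ∧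
      ∀ y ∈ closure Cᶜ ∩ W ⁻¹' Set.Icc (S * (1 / 2 : ℝ) ^ i / 4) S, ∀ p ∈ proxSubdiff W y,
        ‖p‖ ≤ 2 * L → ∃ u ∈ U, ‖u‖ ≤ N ∧ ⟪p, f y u⟫ + p0 * l y u ≤ -(1 / N) := by
    intro i
    have hpos : 0 < S * (1 / 2 : ℝ) ^ i / 4 := by positivity
    refine aux_margin C U f l p0 W hH1 hdec _
      (hWpr _ isCompact_Icc (fun t ht => hpos.le.trans ht.1)) ?_ (2 * L)
    rintro y ⟨hy1, hy2⟩
    exact hnotC y hy1 (hpos.trans_le hy2.1)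
  choose N hN0 hN using hmarg
  set A : ℝ := 2 * L * Lf + p0 * Ll with hA
  have hA0 : 0 < A := by positivity
  let lam : ℕ → ℝ := fun i => 2 * L ^ 2 / (S * ((1 / 2 : ℝ) ^ i) ^ 2) + 2 * N i * L * A
  have hlam0 : ∀ i, 0 < lam i := fun i => by
    have := hN0 i
    simp only [lam]; positivity
  have hlam1 : ∀ i, 2 * L ^ 2 ≤ S * ((1 / 2 : ℝ) ^ i) ^ 2 * lam i := fun i => by
    have h1 := hN0 i
    have h2 : 0 < S * ((1 / 2 : ℝ) ^ i) ^ 2 := by positivity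
    simp only [lam]
    rw [mul_add, mul_div_cancel₀ _ h2.ne']
    have : 0 ≤ S * ((1 / 2 : ℝ) ^ i) ^ 2 * (2 * N i * L * A) := by positivity
    linarith
  have hlam2 : ∀ i, 2 * N i * L * A ≤ lam i := fun i => by
    simp only [lam]
    have : 0 ≤ 2 * L ^ 2 / (S * ((1 / 2 : ℝ) ^ i) ^ 2) := by positivity
    linarith
  have hq1 : ∀ i : ℕ, (1 / 2 : ℝ) ^ i ≤ 1 := fun i => pow_le_one₀ (by norm_num) (by norm_num)
  have hq0 : ∀ i : ℕ, 0 < (1 / 2 : ℝ) ^ i := fun i => by positivity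
  have hGnn : ∀ i, ∀ y ∈ Q, ∀ x, 0 ≤ auxG W S lam i y x := by
    intro i y hy x
    have := hlam0 i
    have h1 := hq1 i
    have h3 := (hQW y hy).1
    unfold auxG
    have : 0 ≤ W y + lam i * ‖x - y‖ ^ 2 := by positivity
    have := mul_nonneg (by linarith : (0:ℝ) ≤ 2 - (1 / 2 : ℝ) ^ i) this
    have h5 : 0 ≤ S * ((1 / 2 : ℝ) ^ i) ^ 2 := by positivity
    linarith
  let V : Euc n → ℝ := fun x => ⨅ q : ℕ × Q, auxG W S lam q.1 q.2 x
  have hbdd : ∀ x, BddBelow (Set.range fun q : ℕ × Q => auxG W S lam q.1 q.2 x) := by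
    intro x
    refine ⟨0, ?_⟩
    rintro _ ⟨q, rfl⟩
    exact hGnn q.1 q.2 q.2.2 x
  have hVle : ∀ x, ∀ i, ∀ y ∈ Q, V x ≤ auxG W S lam i y x := fun x i y hy =>
    ciInf_le (hbdd x) (i, ⟨y, hy⟩)
  have hVnn : ∀ x, 0 ≤ V x := fun x => Real.iInf_nonneg fun q => hGnn q.1 q.2 q.2.2 x
  -- attainment
  have hatt : ∀ x ∈ Q, 0 < W x → ∃ i, ∃ y ∈ Q, V x = auxG W S lam i y x ∧
      (∀ y' ∈ Q, auxG W S lam i y x ≤ auxG W S lam i y' x) ∧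
      V x ≤ 2 * W x - (W x) ^ 2 / (8 * S) := by
    intro x hx hpos
    obtain ⟨i, y, hy, hm, hle⟩ := aux_attain W S L hS lam Q hQ hWQ hlam0 hlam1 x hx
      (hL x hx) hpos (hQW x hx).2
    have hVeq : V x = auxG W S lam i y x := by
      refine le_antisymm (hVle x i y hy) ?_
      have : Nonempty (ℕ × Q) := ⟨(i, ⟨y, hy⟩)⟩
      exact le_ciInf fun q => hm q.1 q.2 q.2.2
    exact ⟨i, y, hy, hVeq, hm i, hVeq ▸ hle⟩
  -- the active data
  have hact : ∀ x ∈ Q, 0 < W x → W x < S → ∃ i : ℕ, ∃ u ∈ U, ∃ p : Euc n,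
      W x / (8 * S) ≤ (1 / 2 : ℝ) ^ i ∧ ‖u‖ ≤ N i ∧ ‖p‖ ≤ 4 * L ∧
      ⟪p, f x u⟫ + p0 * l x u ≤ -(1 / (2 * N i)) ∧
      ∀ x', V x' ≤ V x + ⟪p, x' - x⟫ + 2 * lam i * ‖x' - x‖ ^ 2 := by
    intro x hx hpos hlt
    obtain ⟨i, y, hy, hVeq, hm, hVu⟩ := hatt x hx hpos
    have hlow := auxG_lower W S L lam hlam0 hlam1 i y x (hL x hx y hy)
    have hqi0 := hq0 i
    have hqi1 := hq1 i
    have hli := hlam0 i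
    have hl1 := hlam1 i
    have hl2 := hlam2 i
    have hNi := hN0 i
    have hLxy := hL x hx y hy
    -- first order consequences
    have hmx := hm x hx
    have hfirst : W y + lam i * ‖x - y‖ ^ 2 ≤ W x := by
      unfold auxG at hmx
      simp only [sub_self, norm_zero] at hmx
      have h : (2 - (1 / 2 : ℝ) ^ i) * (W y + lam i * ‖x - y‖ ^ 2) ≤
        (2 - (1 / 2 : ℝ) ^ i) * W x := by nlinarith
      exact le_of_mul_le_mul_left h (by linarith)
    have hdist : lam i * ‖x - y‖ ≤ L := by
      rcases (norm_nonneg (x - y)).eq_or_lt with h0 | h0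
      · rw [← h0]; simpa using hL0.le
      · have : ‖x - y‖ * (lam i * ‖x - y‖) ≤ ‖x - y‖ * L := by nlinarith
        exact le_of_mul_le_mul_left this h0
    have hWyx : W y ≤ W x := by
      have : 0 ≤ lam i * ‖x - y‖ ^ 2 := by positivity
      linarith
    have hsq : 0 ≤ (W x) ^ 2 / (8 * S) := by positivity
    have hqlow : W x / (8 * S) ≤ (1 / 2 : ℝ) ^ i := by
      have h1 : (W x) ^ 2 / (8 * S) ≤ (1 / 2 : ℝ) ^ i * W x := by
        have : 0 ≤ 3 / 4 * (S * ((1 / 2 : ℝ) ^ i) ^ 2) := by positivity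
        rw [← hVeq] at hlow
        linarith
      have h2 : W x / (8 * S) * W x ≤ (1 / 2 : ℝ) ^ i * W x := by
        have he : W x / (8 * S) * W x = (W x) ^ 2 / (8 * S) := by ring
        rw [he]; exact h1
      exact le_of_mul_le_mul_right h2 hpos
    have hWxq : 3 / 4 * (S * (1 / 2 : ℝ) ^ i) ≤ W x := by
      rw [← hVeq] at hlow
      have h1 : (1 / 2 : ℝ) ^ i * (3 / 4 * (S * (1 / 2 : ℝ) ^ i)) ≤ (1 / 2 : ℝ) ^ i * W x := by
        nlinarith
      exact le_of_mul_le_mul_left h1 hqi0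
    have hLd : L * ‖x - y‖ ≤ S * (1 / 2 : ℝ) ^ i / 2 := by
      have h1 : lam i * (L * ‖x - y‖) ≤ lam i * (S * ((1 / 2 : ℝ) ^ i) ^ 2 / 2) := by nlinarith
      have h2 := le_of_mul_le_mul_left h1 hli
      have h3 : S * ((1 / 2 : ℝ) ^ i) ^ 2 ≤ S * (1 / 2 : ℝ) ^ i := by
        apply mul_le_mul_of_nonneg_left _ hS.le
        nlinarith
      linarith
    have hWy : S * (1 / 2 : ℝ) ^ i / 4 ≤ W y := by linarith
    have hWy0 : 0 < W y := lt_of_lt_of_le (by positivity) hWy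
    have hyC : y ∉ C := hnotC y (hQcl hy) hWy0
    -- proximal subgradient
    have hprox : (2 * lam i) • (x - y) ∈ proxSubdiff W y := by
      have hnhds : ∀ᶠ y' in 𝓝 y, y' ∈ Q := by
        have h1 : ∀ᶠ y' in 𝓝 y, y' ∈ Cᶜ := hC.isOpen_compl.mem_nhds hyC
        have hcont : ContinuousAt W y :=
          hWc.continuousAt (mem_of_superset h1 subset_closure)
        have h2 := hcont.eventually (gt_mem_nhds (hWyx.trans_lt hlt))
        filter_upwards [h1, h2] with y' h1 h2
        rw [hQdef]
        exact ⟨subset_closure h1, (hWpd.1 y' h1).le, h2.le⟩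
      obtain ⟨ε, hε, hball⟩ := Metric.eventually_nhds_iff.1 hnhds
      refine ⟨lam i, hli, ε / 2, by positivity, fun y' hy' => ?_⟩
      have hy'Q : y' ∈ Q := hball (by rw [dist_eq_norm]; linarith)
      have hm' := hm y' hy'Q
      unfold auxG at hm'
      have h1 : W y + lam i * ‖x - y‖ ^ 2 ≤ W y' + lam i * ‖x - y'‖ ^ 2 := by
        have h : (2 - (1 / 2 : ℝ) ^ i) * (W y + lam i * ‖x - y‖ ^ 2) ≤
          (2 - (1 / 2 : ℝ) ^ i) * (W y' + lam i * ‖x - y'‖ ^ 2) := by linarith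
        exact le_of_mul_le_mul_left h (by linarith)
      have h2 : ‖x - y'‖ ^ 2 = ‖x - y‖ ^ 2 - 2 * ⟪x - y, y' - y⟫ + ‖y' - y‖ ^ 2 := by
        rw [← norm_sub_sq_real]; congr 2; abel
      rw [h2] at h1
      rw [real_inner_smul_left]
      linarith
    have hpn : ‖(2 * lam i) • (x - y)‖ ≤ 2 * L := by
      rw [norm_smul, Real.norm_eq_abs, abs_of_pos (by positivity)]
      linarith
    obtain ⟨u, hu, huN, hdecr⟩ := hN i y ⟨hQcl hy, hWy, (hQW y hy).2⟩ _ hprox hpn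
    set p : Euc n := (2 * lam i) • (x - y) with hp
    have hlnn : 0 ≤ l x u := hH1.2.2.2.1 x u hu
    have hxu : ⟪p, f x u⟫ + p0 * l x u ≤ -(1 / (2 * N i)) := by
      have e1 : ⟪p, f x u⟫ = ⟪p, f y u⟫ + ⟪p, f x u - f y u⟫ := by
        rw [inner_sub_right]; ring
      have e2 : ⟪p, f x u - f y u⟫ ≤ 2 * L * (Lf * ‖x - y‖) :=
        (real_inner_le_norm _ _).trans
          (mul_le_mul hpn (hLf x hx y hy u hu) (norm_nonneg _) (by positivity))
      have e3 : l x u ≤ l y u + Ll * ‖x - y‖ := by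
        have := (abs_le.1 (hLl x hx y hy u hu)).2
        linarith
      have e4 : p0 * l x u ≤ p0 * (l y u + Ll * ‖x - y‖) :=
        mul_le_mul_of_nonneg_left e3 hp0.le
      have e5 : A * ‖x - y‖ ≤ 1 / (2 * N i) := by
        rw [le_div_iff₀ (by positivity)]
        have h1 : L * (A * ‖x - y‖ * (2 * N i)) ≤ L * 1 := by
          have := mul_le_mul_of_nonneg_right hl2 (norm_nonneg (x - y))
          have e8 : L * (A * ‖x - y‖ * (2 * N i)) = 2 * N i * L * A * ‖x - y‖ := by ring
          rw [e8]
          linarith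
        exact le_of_mul_le_mul_left h1 hL0
      have e6 : 1 / N i = 2 * (1 / (2 * N i)) := by field_simp
      have e7 : A * ‖x - y‖ = 2 * L * (Lf * ‖x - y‖) + p0 * (Ll * ‖x - y‖) := by rw [hA]; ring
      linarith
    refine ⟨i, u, hu, (2 - (1 / 2 : ℝ) ^ i) • p, hqlow, huN, ?_, ?_, ?_⟩
    · rw [norm_smul, Real.norm_eq_abs, abs_of_pos (by linarith)]
      calc (2 - (1 / 2 : ℝ) ^ i) * ‖p‖ ≤ 2 * (2 * L) :=
            mul_le_mul (by linarith) hpn (norm_nonneg _) (by norm_num)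
        _ = 4 * L := by ring
    · rw [real_inner_smul_left]
      have hneg : ⟪p, f x u⟫ + p0 * l x u ≤ 0 :=
        hxu.trans (by have : 0 < 1 / (2 * N i) := by positivity
                      linarith)
      have hpl : 0 ≤ p0 * l x u := mul_nonneg hp0.le hlnn
      nlinarith
    · intro x'
      refine (hVle x' i y hy).trans ?_
      rw [hVeq]
      unfold auxG
      have h2 : ‖x' - y‖ ^ 2 = ‖x' - x‖ ^ 2 + 2 * ⟪x - y, x' - x⟫ + ‖x - y‖ ^ 2 := by
        have : x' - y = (x - y) + (x' - x) := by abel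
        rw [this, norm_add_sq_real]; ring
      rw [h2, real_inner_smul_left, hp, real_inner_smul_left]
      have h3 : 0 ≤ (1 / 2 : ℝ) ^ i * (lam i * ‖x' - x‖ ^ 2) := by positivity
      nlinarith
  -- choose the feedback
  classical
  let good : Euc n → Prop := fun x => x ∈ Q ∧ 0 < W x ∧ W x < S
  let K : Euc n → Euc m := fun x =>
    if h : good x then Classical.choose (Classical.choose_spec (hact x h.1 h.2.1 h.2.2)) else 0
  refine ⟨V, K, hVnn, ?_, ?_⟩
  · intro x hx hxC
    have hpos := hWpd.1 x hxC
    obtain ⟨i, y, hy, hVeq, -, hVu⟩ := hatt x hx hpos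
    have hlow := auxG_lower W S L lam hlam0 hlam1 i y x (hL x hx y hy)
    have : 0 ≤ (W x) ^ 2 / (8 * S) := by positivity
    have h2 : 0 ≤ 3 / 4 * (S * ((1 / 2 : ℝ) ^ i) ^ 2) := by positivity
    have h3 := hq1 i
    constructor
    · rw [hVeq]; nlinarith
    · linarith
  · intro η hη
    obtain ⟨I, hI⟩ := exists_pow_lt_of_lt_one (x := η / (8 * S)) (y := (1 / 2 : ℝ))
      (by positivity) (by norm_num)
    have hsum : ∀ (F : ℕ → ℝ), (∀ i, 0 < F i) → ∀ i < I + 1, F i ≤ ∑ j ∈ Finset.range (I + 1), F j :=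
      fun F hF i hi => Finset.single_le_sum (f := F) (fun j _ => (hF j).le) (by simpa using hi)
    have hNpos : 0 < ∑ j ∈ Finset.range (I + 1), N j :=
      Finset.sum_pos (fun j _ => hN0 j) ⟨0, by simp⟩
    refine ⟨∑ j ∈ Finset.range (I + 1), N j, hNpos,
      ∑ j ∈ Finset.range (I + 1), 2 * lam j,
      Finset.sum_nonneg fun j _ => by have := hlam0 j; positivity, ?_⟩
    intro x hx hηx hxS
    have hg : good x := ⟨hx, hη.trans_le hηx, hxS⟩
    have hKx : K x = Classical.choose (Classical.choose_spec (hact x hg.1 hg.2.1 hg.2.2)) :=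
      dif_pos hg
    have hspec := Classical.choose_spec (Classical.choose_spec (hact x hg.1 hg.2.1 hg.2.2))
    rw [← hKx] at hspec
    generalize Classical.choose (hact x hg.1 hg.2.1 hg.2.2) = i at hspec
    obtain ⟨hKU, p, hqi, hKN, hp4, hpd, hpV⟩ := hspec
    have hiI : i < I + 1 := by
      by_contra hcon
      have h1 : (1 / 2 : ℝ) ^ i ≤ (1 / 2 : ℝ) ^ I :=
        pow_le_pow_of_le_one (by norm_num) (by norm_num) (by omega)
      have h2 : η / (8 * S) ≤ W x / (8 * S) := div_le_div_of_nonneg_right hηx (by positivity)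
      linarith
    refine ⟨hKU, hKN.trans (hsum N hN0 i hiI), p, hp4, hpd.trans ?_, fun x' => (hpV x').trans ?_⟩
    · have h1 := hsum N hN0 i hiI
      have h2 := hN0 i
      have : 1 / (2 * ∑ j ∈ Finset.range (I + 1), N j) ≤ 1 / (2 * N i) :=
        one_div_le_one_div_of_le (by positivity) (by linarith)
      linarith
    · have h1 := hsum (fun j => 2 * lam j) (fun j => by have := hlam0 j; positivity) i hiI
      have := mul_le_mul_of_nonneg_right h1 (sq_nonneg ‖x' - x‖)
      linarith

/-- A priori estimates over one sampling interval. -/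
theorem aux_step {n m : ℕ} (C : Set (Euc n)) (U : Set (Euc m))
    (f : Euc n → Euc m → Euc n) (l : Euc n → Euc m → ℝ) (Kc : Set (Euc n)) (M Lf Ll : ℝ)
    (hM : 0 < M) (hLf0 : 0 < Lf) (hLl0 : 0 < Ll)
    (hlc : ContinuousOn (fun q : Euc n × Euc m => l q.1 q.2) (closure Cᶜ ×ˢ U))
    (hfM : ∀ y ∈ Kc, ∀ u ∈ U, ‖f y u‖ ≤ M)
    (hfL : ∀ y ∈ Kc, ∀ z ∈ Kc, ∀ u ∈ U, ‖f y u - f z u‖ ≤ Lf * ‖y - z‖)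
    (hlL : ∀ y ∈ Kc, ∀ z ∈ Kc, ∀ u ∈ U, |l y u - l z u| ≤ Ll * ‖y - z‖)
    (x : ℝ → Euc n) (u : Euc m) (hu : u ∈ U) (a b : ℝ) (hab : a ≤ b) (hMab : M * (b - a) < 1)
    (hKc : ∀ y, y ∉ C → ‖y - x a‖ ≤ 1 → y ∈ Kc)
    (hx : ContinuousOn x (Set.Icc a b)) (hout : ∀ t ∈ Set.Icc a b, x t ∉ C)
    (hd : ∀ t ∈ Set.Ioo a b, HasDerivAt x (f (x t) u) t) :
    (∀ t ∈ Set.Icc a b, x t ∈ Kc ∧ ‖x t - x a‖ ≤ M * (t - a)) ∧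
    ‖x b - x a - (b - a) • f (x a) u‖ ≤ Lf * M * (b - a) ^ 2 ∧
    IntervalIntegrable (fun τ => l (x τ) u) volume a b ∧
    (∫ τ in a..b, l (x τ) u) ≤ (b - a) * l (x a) u + Ll * M * (b - a) ^ 2 := by
  have hmv : ∀ t ∈ Set.Icc a b, (∀ s ∈ Set.Ioo a t, ‖x s - x a‖ ≤ 1) →
      ‖x t - x a‖ ≤ M * (t - a) := by
    intro t ht hs
    refine aux_mvt x (fun s => f (x s) u) a t M ht.1 (hx.mono (Set.Icc_subset_Icc_right ht.2))
      (fun s hs => hd s ⟨hs.1, hs.2.trans_le ht.2⟩) (fun s hs' => ?_)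
    exact hfM _ (hKc _ (hout s ⟨hs'.1.le, hs'.2.le.trans ht.2⟩) (hs s hs')) u hu
  have hsmall : ∀ t ∈ Set.Icc a b, ‖x t - x a‖ < 1 := by
    by_contra hcon
    push Not at hcon
    have hcpt : IsCompact (Set.Icc a b ∩ (fun t => ‖x t - x a‖) ⁻¹' Set.Ici 1) :=
      isCompact_Icc.of_isClosed_subset
        ((hx.sub continuousOn_const).norm.preimage_isClosed_of_isClosed isClosed_Icc isClosed_Ici)
        Set.inter_subset_left
    obtain ⟨t1, ⟨ht1, ht1'⟩, hleast⟩ := hcpt.exists_isLeast (by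
      obtain ⟨t, ht, ht'⟩ := hcon
      exact ⟨t, ht, ht'⟩)
    have h1 := hmv t1 ht1 (fun s hs => by
      by_contra hgt
      push Not at hgt
      have := hleast ⟨⟨hs.1.le, hs.2.le.trans ht1.2⟩, hgt.le⟩
      exact absurd this (not_le.2 hs.2))
    have h2 : M * (t1 - a) ≤ M * (b - a) := mul_le_mul_of_nonneg_left (by linarith [ht1.2]) hM.le
    have h3 : (1 : ℝ) ≤ ‖x t1 - x a‖ := ht1'
    linarith
  have hdist : ∀ t ∈ Set.Icc a b, ‖x t - x a‖ ≤ M * (t - a) := fun t ht =>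
    hmv t ht fun s hs => (hsmall s ⟨hs.1.le, hs.2.le.trans ht.2⟩).le
  have hmem : ∀ t ∈ Set.Icc a b, x t ∈ Kc := fun t ht => hKc _ (hout t ht) (hsmall t ht).le
  have ha : a ∈ Set.Icc a b := ⟨le_rfl, hab⟩
  have hdist' : ∀ t ∈ Set.Icc a b, ‖x t - x a‖ ≤ M * (b - a) := fun t ht =>
    (hdist t ht).trans (mul_le_mul_of_nonneg_left (by linarith [ht.2]) hM.le)
  refine ⟨fun t ht => ⟨hmem t ht, hdist t ht⟩, ?_, ?_⟩
  · have := aux_mvt (fun t => x t - (t - a) • f (x a) u) (fun t => f (x t) u - f (x a) u) a b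
      (Lf * (M * (b - a))) hab
      (hx.sub (((continuous_id.sub continuous_const).smul continuous_const).continuousOn))
      (fun t ht => by
        have h1 : HasDerivAt (fun t : ℝ => (t - a) • f (x a) u) ((1 : ℝ) • f (x a) u) t :=
          ((hasDerivAt_id t).sub_const a).smul_const _
        rw [one_smul] at h1
        exact (hd t ht).sub h1)
      (fun t ht => (hfL _ (hmem t ⟨ht.1.le, ht.2.le⟩) _ (hmem a ha) u hu).trans
        (mul_le_mul_of_nonneg_left (hdist' t ⟨ht.1.le, ht.2.le⟩) hLf0.le))
    simp only [sub_self, zero_smul, sub_zero] at this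
    have e : x b - (b - a) • f (x a) u - x a = x b - x a - (b - a) • f (x a) u := by abel
    rw [e] at this
    refine this.trans (le_of_eq (by ring))
  · have hcont : ContinuousOn (fun τ => l (x τ) u) (Set.Icc a b) := by
      refine hlc.comp (f := fun τ => (x τ, u)) (hx.prodMk continuousOn_const) ?_
      intro t ht
      exact ⟨subset_closure (hout t ht), hu⟩
    have hIntg : IntervalIntegrable (fun τ => l (x τ) u) volume a b :=
      ContinuousOn.intervalIntegrable (by rwa [Set.uIcc_of_le hab])
    refine ⟨hIntg, ?_⟩
    have := intervalIntegral.integral_mono_on (μ := volume) hab hIntg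
      (intervalIntegrable_const (c := l (x a) u + Ll * (M * (b - a)))) (fun t ht => by
        have h1 := (abs_le.1 (hlL _ (hmem t ht) _ (hmem a ha) u hu)).2
        have h2 := mul_le_mul_of_nonneg_left (hdist' t ht) hLl0.le
        linarith)
    refine this.trans (le_of_eq ?_)
    simp only [intervalIntegral.integral_const, smul_eq_mul]
    ring

/-- Construction of the comparison function. -/
theorem aux_KL (Cs Ts : ℕ → ℝ) (D : ℝ) (hCs : ∀ k, 0 ≤ Cs k) (hD : 0 ≤ D) :
    ∃ β : ℝ → ℝ → ℝ, IsKL β ∧ ∀ R t d : ℝ, 0 ≤ R → 0 ≤ t → 0 ≤ d → d ≤ D →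
      (∀ k : ℕ, d ≤ 1 / ((k : ℝ) + 1) + Cs k * R) →
      (∀ k : ℕ, Ts k < t → d ≤ 1 / ((k : ℝ) + 1)) → d ≤ β R t := by
  classical
  let a : ℕ → ℝ → ℝ := fun k R => 1 / ((k : ℝ) + 1) + Cs k * R
  let A0 : ℝ → ℝ := fun R => ⨅ k, a k R
  let b : ℕ → ℝ → ℝ := fun k t => 1 / ((k : ℝ) + 1) + if Ts k < t then 0 else D
  let B0 : ℝ → ℝ := fun t => ⨅ k, b k t
  have ha0 : ∀ k R, 0 ≤ R → 0 ≤ a k R := fun k R hR => by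
    have := hCs k
    simp only [a]; positivity
  have hb0 : ∀ k t, 0 ≤ b k t := fun k t => by
    simp only [b]
    split_ifs <;> positivity
  have hba : ∀ R, 0 ≤ R → BddBelow (Set.range fun k => a k R) := fun R hR =>
    ⟨0, by rintro _ ⟨k, rfl⟩; exact ha0 k R hR⟩
  have hbb : ∀ t, BddBelow (Set.range fun k => b k t) := fun t =>
    ⟨0, by rintro _ ⟨k, rfl⟩; exact hb0 k t⟩
  have hA0nn : ∀ R, 0 ≤ R → 0 ≤ A0 R := fun R hR => Real.iInf_nonneg fun k => ha0 k R hR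
  have hB0nn : ∀ t, 0 ≤ B0 t := fun t => Real.iInf_nonneg fun k => hb0 k t
  have hA0mono : ∀ R R', 0 ≤ R → R ≤ R' → A0 R ≤ A0 R' := by
    intro R R' hR hRR
    refine ciInf_mono (hba R hR) fun k => ?_
    have := mul_le_mul_of_nonneg_left hRR (hCs k)
    simp only [a]; linarith
  have hB0anti : ∀ t t', t ≤ t' → B0 t' ≤ B0 t := by
    intro t t' htt
    refine ciInf_mono (hbb t') fun k => ?_
    simp only [b]
    have : (if Ts k < t' then 0 else D) ≤ (if Ts k < t then 0 else D) := by
      split_ifs <;> linarith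
    linarith
  -- smallness
  have hAsmall : ∀ ε > 0, ∃ δ > 0, ∀ h, 0 ≤ h → h < δ → A0 h < ε := by
    intro ε hε
    obtain ⟨k, hk⟩ := exists_nat_one_div_lt (half_pos hε)
    refine ⟨ε / (2 * (Cs k + 1)), by have := hCs k; positivity, fun h h0 hh => ?_⟩
    refine (ciInf_le (hba h h0) k).trans_lt ?_
    have h1 := hCs k
    rw [lt_div_iff₀ (by positivity)] at hh
    simp only [a]
    nlinarith
  have hA00 : A0 0 = 0 := by
    refine le_antisymm (le_of_forall_pos_le_add fun ε hε => ?_) (hA0nn 0 le_rfl)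
    obtain ⟨δ, hδ, h⟩ := hAsmall ε hε
    linarith [h 0 le_rfl hδ]
  have hsub : ∀ R h, 0 ≤ R → 0 ≤ h → A0 (R + h) ≤ A0 R + A0 h := by
    intro R h hR hh
    refine le_ciInf_add_ciInf fun i j => ?_
    rcases le_total (Cs i) (Cs j) with hij | hij
    · refine (ciInf_le (hba _ (by positivity)) i).trans ?_
      have h1 := mul_le_mul_of_nonneg_right hij hh
      have h2 : 0 ≤ 1 / ((j : ℝ) + 1) := by positivity
      simp only [a]; linarith
    · refine (ciInf_le (hba _ (by positivity)) j).trans ?_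
      have h1 := mul_le_mul_of_nonneg_right hij hR
      have h2 : 0 ≤ 1 / ((i : ℝ) + 1) := by positivity
      simp only [a]; linarith
  have hA0cont : ContinuousOn A0 (Set.Ici 0) := by
    rw [Metric.continuousOn_iff]
    intro R hR ε hε
    obtain ⟨δ, hδ, h⟩ := hAsmall ε hε
    refine ⟨δ, hδ, fun R' hR' hd => ?_⟩
    simp only [Set.mem_Ici] at hR hR'
    rw [Real.dist_eq] at hd ⊢
    rcases le_total R R' with hle | hle
    · rw [abs_of_nonneg (by linarith)] at hd
      have h1 := hA0mono R R' hR hle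
      have h2 := hsub R (R' - R) hR (by linarith)
      rw [add_sub_cancel] at h2
      rw [abs_of_nonneg (by linarith)]
      linarith [h (R' - R) (by linarith) hd]
    · rw [abs_of_nonpos (by linarith)] at hd
      have h1 := hA0mono R' R hR' hle
      have h2 := hsub R' (R - R') hR' (by linarith)
      rw [add_sub_cancel] at h2
      rw [abs_of_nonpos (by linarith)]
      linarith [h (R - R') (by linarith) (by linarith)]
  have hBlim : Tendsto (fun t => B0 t + 1 / (t + 1)) atTop (𝓝 (0 + 0)) := by
    refine Tendsto.add ?_ ?_
    · rw [Metric.tendsto_atTop]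
      intro ε hε
      obtain ⟨k, hk⟩ := exists_nat_one_div_lt hε
      refine ⟨Ts k + 1, fun t ht => ?_⟩
      rw [Real.dist_eq, sub_zero, abs_of_nonneg (hB0nn t)]
      refine (ciInf_le (hbb t) k).trans_lt ?_
      simp only [b]
      rw [if_pos (by linarith)]
      linarith
    · have : Tendsto (fun t : ℝ => t + 1) atTop atTop := tendsto_atTop_add_const_right _ _ tendsto_id
      simp only [one_div]
      exact this.inv_tendsto_atTop
  have hBpos : ∀ t, 0 ≤ t → 0 < B0 t + 1 / (t + 1) := fun t ht => by
    have := hB0nn t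
    positivity
  refine ⟨fun R t => Real.sqrt ((A0 R + R) * (B0 t + 1 / (t + 1))), ?_, ?_⟩
  · constructor
    · intro r t _ _; exact Real.sqrt_nonneg _
    · intro t ht
      exact ((hA0cont.add continuousOn_id).mul continuousOn_const).sqrt
    · intro t ht R hR R' hR' hlt
      simp only [Set.mem_Ici] at hR hR'
      have h1 := hA0mono R R' hR hlt.le
      have h2 := hA0nn R hR
      have h3 := hBpos t ht
      exact Real.sqrt_lt_sqrt (mul_nonneg (by linarith) h3.le)
        (mul_lt_mul_of_pos_right (by linarith) h3)
    · intro t ht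
      simp [hA00]
    · intro R hR t ht t' ht' hle
      simp only [Set.mem_Ici] at ht ht'
      have h2 := hA0nn R hR
      apply Real.sqrt_le_sqrt
      apply mul_le_mul_of_nonneg_left _ (by linarith)
      have h3 : 1 / (t' + 1) ≤ 1 / (t + 1) :=
        one_div_le_one_div_of_le (by linarith) (by linarith)
      linarith [hB0anti t t' hle]
    · intro R hR
      have := (hBlim.const_mul (A0 R + R)).sqrt
      simpa using this
  · intro R t d hR ht hd hdD h1 h2
    have hA : d ≤ A0 R + R := by
      have : d ≤ A0 R := le_ciInf h1
      linarith
    have hB : d ≤ B0 t + 1 / (t + 1) := by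
      have h3 : d ≤ B0 t := by
        refine le_ciInf fun k => ?_
        simp only [b]
        split_ifs with hk
        · simpa using h2 k hk
        · have : 0 ≤ 1 / ((k : ℝ) + 1) := by positivity
          linarith
      have : 0 ≤ 1 / (t + 1) := by positivity
      linarith
    apply Real.le_sqrt_of_sq_le
    rw [sq]
    exact mul_le_mul hA hB hd (hd.trans hA)

theorem aux_index (π : TimePartition) (s : ℝ) (hs : 0 ≤ s) :
    ∃ j, π.t j ≤ s ∧ s < π.t (j + 1) := by
  classical
  have hex : ∃ k, s < π.t k := (π.unbounded.eventually (eventually_gt_atTop s)).exists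
  have h1 := Nat.find_spec hex
  have h0 : Nat.find hex ≠ 0 := by
    intro h
    rw [h, π.zero] at h1
    linarith
  obtain ⟨j, hj⟩ := Nat.exists_eq_succ_of_ne_zero h0
  refine ⟨j, not_lt.1 (Nat.find_min hex (by omega)), ?_⟩
  rw [hj] at h1
  exact h1

set_option maxHeartbeats 1000000 in
/-- Behaviour of sampling trajectories relative to one level `ν`. -/
theorem aux_level {n m : ℕ} (C : Set (Euc n)) (U : Set (Euc m))
    (f : Euc n → Euc m → Euc n) (l : Euc n → Euc m → ℝ)
    (p0 : ℝ) (W : Euc n → ℝ) (hH1 : HypH1 C U f l) (hp0 : 0 < p0)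
    (hWpd : PosDefOn C W) (σ L Lf Ll M : ℝ) (hσ : 0 < σ)
    (hL0 : 0 < L) (hLf0 : 0 < Lf) (hLl0 : 0 < Ll) (hM : 0 < M)
    (Q Kc : Set (Euc n)) (hQdef : Q = closure Cᶜ ∩ W ⁻¹' Set.Icc 0 (2 * σ + 1))
    (hQK : ∀ x ∈ Q, ∀ y, y ∉ C → ‖y - x‖ ≤ 1 → y ∈ Kc)
    (hL : ∀ x ∈ Kc, ∀ y ∈ Kc, W x - W y ≤ L * ‖x - y‖)
    (hfM : ∀ y ∈ Kc, ∀ u ∈ U, ‖f y u‖ ≤ M)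
    (hLf : ∀ x ∈ Kc, ∀ y ∈ Kc, ∀ u ∈ U, ‖f x u - f y u‖ ≤ Lf * ‖x - y‖)
    (hLl : ∀ x ∈ Kc, ∀ y ∈ Kc, ∀ u ∈ U, |l x u - l y u| ≤ Ll * ‖x - y‖)
    (V : Euc n → ℝ) (K : Euc n → Euc m) (hV0 : ∀ x, 0 ≤ V x)
    (hVW : ∀ x ∈ Q, x ∉ C → W x ≤ V x ∧ V x ≤ 2 * W x)
    (hVK : ∀ η : ℝ, 0 < η → ∃ N : ℝ, 0 < N ∧ ∃ Λ : ℝ, 0 ≤ Λ ∧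
        ∀ x ∈ Q, η ≤ W x → W x < 2 * σ + 1 → K x ∈ U ∧ ‖K x‖ ≤ N ∧
          ∃ p : Euc n, ‖p‖ ≤ 4 * L ∧ ⟪p, f x (K x)⟫ + p0 * l x (K x) ≤ -(1 / (2 * N)) ∧
            ∀ x', V x' ≤ V x + ⟪p, x' - x⟫ + Λ * ‖x' - x‖ ^ 2)
    (ν : ℝ) (hν : 0 < ν) (hνσ : 4 * ν ≤ 2 * σ) :
    ∃ δ > (0 : ℝ), ∃ Tν : ℝ, 0 ≤ Tν ∧ ∀ π : TimePartition, (∀ j, π.t (j+1) - π.t j ≤ δ) →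
      ∀ z, z ∉ C → W z ≤ σ → ∀ x u T, IsSamplingSol C U f K π z x u T →
        ∀ t, 0 ≤ t → ENNReal.ofReal t < T →
          x t ∈ Q ∧ W (x t) ≤ max (2 * W z) (4 * ν) ∧ (Tν < t → W (x t) ≤ 4 * ν) ∧
          ((∀ s, t ≤ s → ENNReal.ofReal s < T → W (x s) ≤ 4 * ν) ∨
            p0 * (∫ τ in (0:ℝ)..t, l (x τ) (u τ)) ≤ 2 * W z) := by
  obtain ⟨hC, -, -, hlnn, -, hlc, -⟩ := hH1
  obtain ⟨N, hN, Λ, hΛ, hLy⟩ := hVK ν hν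
  set mm : ℝ := 1 / (2 * N) with hmm
  have hmm0 : 0 < mm := by positivity
  set cst : ℝ := 4 * L * (Lf * M) + p0 * (Ll * M) + Λ * M ^ 2 with hcst
  have hcst0 : 0 < cst := by positivity
  have hQmem : ∀ y, y ∉ C → W y ≤ 2 * σ + 1 → y ∈ Q := by
    intro y hy hWy
    rw [hQdef]
    exact ⟨subset_closure hy, (hWpd.1 y hy).le, hWy⟩
  refine ⟨min (1 / (2 * M)) (min (1 / (2 * (L * M))) (min (ν / (L * M)) (mm / (2 * cst)))),
    by positivity, 4 * σ / mm, by positivity, ?_⟩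
  intro π hπ z hzC hzσ x u T hsol
  have hd1 : ∀ j s, s ≤ π.t (j + 1) → M * (s - π.t j) < 1 ∧ L * (M * (s - π.t j)) ≤ 1 / 2 ∧
      L * (M * (s - π.t j)) ≤ ν ∧ cst * (s - π.t j) ≤ mm / 2 := by
    intro j s hs
    have h := hπ j
    simp only [le_min_iff] at h
    obtain ⟨h1, h2, h3, h4⟩ := h
    rw [le_div_iff₀ (by positivity)] at h1 h2 h3 h4
    have hle : s - π.t j ≤ π.t (j + 1) - π.t j := by linarith
    have g1 := mul_le_mul_of_nonneg_left hle hM.le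
    have g2 := mul_le_mul_of_nonneg_left hle (mul_pos hL0 hM).le
    have g3 := mul_le_mul_of_nonneg_left hle hcst0.le
    refine ⟨?_, ?_, ?_, ?_⟩ <;> nlinarith
  have hout : ∀ s, 0 ≤ s → ENNReal.ofReal s < T → x s ∉ C := hsol.outside
  have htj0 : ∀ j, 0 ≤ π.t j := fun j => by
    rw [← π.zero]; exact π.mono.monotone (Nat.zero_le j)
  have hmonoT : ∀ s s', s ≤ s' → ENNReal.ofReal s' < T → ENNReal.ofReal s < T := fun s s' h h' =>
    (ENNReal.ofReal_le_ofReal h).trans_lt h'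
  -- one step
  have hstep : ∀ j s, π.t j ≤ s → s ≤ π.t (j + 1) → ENNReal.ofReal s < T →
      x (π.t j) ∈ Q → V (x (π.t j)) ≤ 2 * σ →
      x s ∈ Q ∧ (W (x (π.t j)) < ν → V (x s) ≤ 4 * ν) ∧
      (ν ≤ W (x (π.t j)) →
        IntervalIntegrable (fun τ => l (x τ) (u τ)) volume (π.t j) s ∧
        0 ≤ (∫ τ in (π.t j)..s, l (x τ) (u τ)) ∧
        V (x s) + p0 * (∫ τ in (π.t j)..s, l (x τ) (u τ)) + mm / 2 * (s - π.t j)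
          ≤ V (x (π.t j))) := by
    intro j s hjs hsj hsT hxQ hVσ
    have hxC : x (π.t j) ∉ C := hout _ (htj0 j) (hmonoT _ _ hjs hsT)
    have hWpos := hWpd.1 _ hxC
    have hWle : W (x (π.t j)) ≤ 2 * σ := (hVW _ hxQ hxC).1.trans hVσ
    have hKU : K (x (π.t j)) ∈ U := by
      obtain ⟨N', -, Λ', -, h⟩ := hVK (W (x (π.t j))) hWpos
      exact (h _ hxQ le_rfl (by linarith)).1
    obtain ⟨e1, e2, e3, e4⟩ := hd1 j s hsj
    obtain ⟨hdist, hlin, hIntg, hintle⟩ := aux_step C U f l Kc M Lf Ll hM hLf0 hLl0 hlc hfM hLf hLl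
      x (K (x (π.t j))) hKU (π.t j) s hjs e1 (hQK _ hxQ)
      (hsol.cont.mono fun t ht => (htj0 j).trans ht.1)
      (fun t ht => hout t ((htj0 j).trans ht.1) (hmonoT _ _ ht.2 hsT))
      (fun t ht => by
        have hu := hsol.ctrl j t ⟨ht.1.le, ht.2.trans_le hsj⟩
        rw [← hu]
        refine hsol.deriv t ((htj0 j).trans_lt ht.1) (hmonoT _ _ ht.2.le hsT) ?_
        intro i hi
        have h1 : j < i := π.mono.lt_iff_lt.1 (hi ▸ ht.1)
        have h2 : i < j + 1 := π.mono.lt_iff_lt.1 (hi ▸ ht.2.trans_le hsj)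
        omega)
    have hsC : x s ∉ C := hout s ((htj0 j).trans hjs) hsT
    obtain ⟨hsK, hsd⟩ := hdist s ⟨hjs, le_rfl⟩
    obtain ⟨hjK, -⟩ := hdist (π.t j) ⟨le_rfl, hjs⟩
    have hWs : W (x s) ≤ W (x (π.t j)) + L * (M * (s - π.t j)) := by
      have h1 := hL _ hsK _ hjK
      have h2 := mul_le_mul_of_nonneg_left hsd hL0.le
      linarith
    have hsQ : x s ∈ Q := hQmem _ hsC (by linarith)
    refine ⟨hsQ, ?_, ?_⟩
    · intro hlt
      have := (hVW _ hsQ hsC).2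
      linarith
    · intro hge
      obtain ⟨-, -, p, hp4, hpd, hpV⟩ := hLy _ hxQ hge (by linarith)
      have hae : ∀ τ ∈ Set.uIoo (π.t j) s, l (x τ) (K (x (π.t j))) = l (x τ) (u τ) := by
        intro τ hτ
        rw [Set.uIoo_of_le hjs] at hτ
        rw [hsol.ctrl j τ ⟨hτ.1.le, hτ.2.trans_le hsj⟩]
      have hIntg' : IntervalIntegrable (fun τ => l (x τ) (u τ)) volume (π.t j) s :=
        hIntg.congr_uIoo hae
      have hinteq : (∫ τ in (π.t j)..s, l (x τ) (u τ)) =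
          ∫ τ in (π.t j)..s, l (x τ) (K (x (π.t j))) :=
        intervalIntegral.integral_congr_uIoo fun τ hτ => (hae τ hτ).symm
      refine ⟨hIntg', ?_, ?_⟩
      · rw [hinteq]
        exact intervalIntegral.integral_nonneg hjs fun τ _ => hlnn _ _ hKU
      · rw [hinteq]
        set h := s - π.t j with hh
        have hh0 : 0 ≤ h := by rw [hh]; linarith
        set ξ := x (π.t j) with hξ
        have h1 := hpV (x s)
        have h2 : ⟪p, x s - ξ⟫ ≤ h * ⟪p, f ξ (K ξ)⟫ + 4 * L * (Lf * M * h ^ 2) := by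
          have e : x s - ξ = h • f ξ (K ξ) + (x s - ξ - h • f ξ (K ξ)) := by abel
          rw [e, inner_add_right, real_inner_smul_right]
          have := (real_inner_le_norm p (x s - ξ - h • f ξ (K ξ))).trans
            (mul_le_mul hp4 hlin (norm_nonneg _) (by positivity))
          linarith
        have h3 : Λ * ‖x s - ξ‖ ^ 2 ≤ Λ * (M * h) ^ 2 :=
          mul_le_mul_of_nonneg_left (pow_le_pow_left₀ (norm_nonneg _) hsd 2) hΛ
        have h4 := mul_le_mul_of_nonneg_left hintle hp0.le
        have h5 := mul_le_mul_of_nonneg_left hpd hh0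
        have h6 := mul_le_mul_of_nonneg_left e4 hh0
        have h7 : h * (cst * h) = 4 * L * (Lf * M * h ^ 2) + p0 * (Ll * M * h ^ 2)
            + Λ * (M * h) ^ 2 := by rw [hcst]; ring
        rw [h7] at h6
        have h8 : h * (⟪p, f ξ (K ξ)⟫ + p0 * l ξ (K ξ)) =
          h * ⟪p, f ξ (K ξ)⟫ + p0 * (h * l ξ (K ξ)) := by ring
        rw [h8] at h5
        have h9 : p0 * (h * l ξ (K ξ) + Ll * M * h ^ 2) =
          p0 * (h * l ξ (K ξ)) + p0 * (Ll * M * h ^ 2) := by ring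
        rw [h9] at h4
        linarith
  -- the initial point
  have hx0 : x 0 = z := hsol.init
  have hzpos := hWpd.1 z hzC
  have hzQ : z ∈ Q := hQmem z hzC (by linarith)
  have hVz : V z ≤ 2 * W z := (hVW z hzQ hzC).2
  let A : ℝ → Prop := fun t => IntervalIntegrable (fun τ => l (x τ) (u τ)) volume 0 t ∧
    0 ≤ (∫ τ in (0:ℝ)..t, l (x τ) (u τ)) ∧
    V (x t) + p0 * (∫ τ in (0:ℝ)..t, l (x τ) (u τ)) + mm / 2 * t ≤ V z
  have hAV : ∀ t, 0 ≤ t → A t → V (x t) ≤ V z := by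
    rintro t ht ⟨-, h1, h2⟩
    have := mul_nonneg hp0.le h1
    have h3 : 0 ≤ mm / 2 * t := by positivity
    linarith
  have hAstep : ∀ j s, π.t j ≤ s → A (π.t j) →
      (IntervalIntegrable (fun τ => l (x τ) (u τ)) volume (π.t j) s ∧
        0 ≤ (∫ τ in (π.t j)..s, l (x τ) (u τ)) ∧
        V (x s) + p0 * (∫ τ in (π.t j)..s, l (x τ) (u τ)) + mm / 2 * (s - π.t j)
          ≤ V (x (π.t j))) → A s := by
    rintro j s hjs ⟨a1, a2, a3⟩ ⟨b1, b2, b3⟩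
    have hadd := intervalIntegral.integral_add_adjacent_intervals a1 b1
    refine ⟨a1.trans b1, ?_, ?_⟩
    · rw [← hadd]; linarith
    · rw [← hadd, mul_add]
      linarith
  have hF : ∀ j, ENNReal.ofReal (π.t j) < T →
      x (π.t j) ∈ Q ∧ V (x (π.t j)) ≤ 2 * σ ∧ (A (π.t j) ∨ V (x (π.t j)) ≤ 4 * ν) := by
    intro j
    induction j with
    | zero =>
      intro _
      rw [π.zero, hx0]
      refine ⟨hzQ, by linarith, Or.inl ⟨by simp, by simp, ?_⟩⟩
      simp [hx0]
    | succ j ih =>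
      intro hT
      have hlt : π.t j < π.t (j + 1) := π.mono (Nat.lt_succ_self j)
      obtain ⟨hQj, hVj, hor⟩ := ih (hmonoT _ _ hlt.le hT)
      obtain ⟨hQs, hs1, hs2⟩ := hstep j (π.t (j + 1)) hlt.le le_rfl hT hQj hVj
      have hor' : A (π.t (j + 1)) ∨ V (x (π.t (j + 1))) ≤ 4 * ν := by
        rcases lt_or_ge (W (x (π.t j))) ν with hlt' | hge
        · exact Or.inr (hs1 hlt')
        · rcases hor with hA | hB
          · exact Or.inl (hAstep j _ hlt.le hA (hs2 hge))
          · right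
            obtain ⟨-, b2, b3⟩ := hs2 hge
            have := mul_nonneg hp0.le b2
            have h3 : 0 ≤ mm / 2 * (π.t (j + 1) - π.t j) := mul_nonneg (by positivity) (by linarith)
            linarith
      refine ⟨hQs, ?_, hor'⟩
      rcases hor' with hA | hB
      · have := hAV _ (htj0 _) hA
        linarith
      · linarith
  have hBs : ∀ j s, π.t j ≤ s → s ≤ π.t (j + 1) → ENNReal.ofReal s < T →
      V (x (π.t j)) ≤ 4 * ν → V (x s) ≤ 4 * ν := by
    intro j s hjs hsj hT hB
    obtain ⟨hQj, hVj, -⟩ := hF j (hmonoT _ _ hjs hT)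
    obtain ⟨hQs, hs1, hs2⟩ := hstep j s hjs hsj hT hQj hVj
    rcases lt_or_ge (W (x (π.t j))) ν with hlt' | hge
    · exact hs1 hlt'
    · obtain ⟨-, b2, b3⟩ := hs2 hge
      have := mul_nonneg hp0.le b2
      have h3 : 0 ≤ mm / 2 * (s - π.t j) := mul_nonneg (by positivity) (by linarith)
      linarith
  have hBsamp : ∀ j, V (x (π.t j)) ≤ 4 * ν → ∀ k, ENNReal.ofReal (π.t (j + k)) < T →
      V (x (π.t (j + k))) ≤ 4 * ν := by
    intro j hB k
    induction k with
    | zero => intro _; exact hB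
    | succ k ih =>
      intro hT
      have hlt : π.t (j + k) < π.t (j + k + 1) := π.mono (Nat.lt_succ_self _)
      exact hBs (j + k) _ hlt.le le_rfl hT (ih (hmonoT _ _ hlt.le hT))
  have hBall : ∀ j, V (x (π.t j)) ≤ 4 * ν → ∀ s, π.t j ≤ s → ENNReal.ofReal s < T →
      V (x s) ≤ 4 * ν := by
    intro j hB s hjs hT
    obtain ⟨i, hi1, hi2⟩ := aux_index π s ((htj0 j).trans hjs)
    have hji : j ≤ i := by
      have : j < i + 1 := π.mono.lt_iff_lt.1 (hjs.trans_lt hi2)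
      omega
    obtain ⟨k, rfl⟩ := Nat.exists_eq_add_of_le hji
    exact hBs _ s hi1 hi2.le hT (hBsamp j hB k (hmonoT _ _ hi1 hT))
  -- main dichotomy
  have hE : ∀ t, 0 ≤ t → ENNReal.ofReal t < T → x t ∈ Q ∧
      (A t ∨ ∀ s, t ≤ s → ENNReal.ofReal s < T → V (x s) ≤ 4 * ν) := by
    intro t ht hT
    obtain ⟨j, hj1, hj2⟩ := aux_index π t ht
    obtain ⟨hQj, hVj, hor⟩ := hF j (hmonoT _ _ hj1 hT)
    obtain ⟨hQs, hs1, hs2⟩ := hstep j t hj1 hj2.le hT hQj hVj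
    refine ⟨hQs, ?_⟩
    rcases hor with hA | hB
    · rcases lt_or_ge (W (x (π.t j))) ν with hlt' | hge
      · right
        intro s hs hsT
        rcases le_total s (π.t (j + 1)) with hle | hle
        · exact (hstep j s (hj1.trans hs) hle hsT hQj hVj).2.1 hlt'
        · have hTn := hmonoT _ _ hle hsT
          have hlt : π.t j < π.t (j + 1) := π.mono (Nat.lt_succ_self j)
          exact hBall (j + 1) ((hstep j _ hlt.le le_rfl hTn hQj hVj).2.1 hlt') s hle hsT
      · exact Or.inl (hAstep j t hj1 hA (hs2 hge))
    · exact Or.inr fun s hs hsT => hBall j hB s (hj1.trans hs) hsT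
  have hWV : ∀ s, 0 ≤ s → ENNReal.ofReal s < T → W (x s) ≤ V (x s) := fun s hs hsT =>
    (hVW _ (hE s hs hsT).1 (hout s hs hsT)).1
  intro t ht hT
  obtain ⟨hQt, hor⟩ := hE t ht hT
  refine ⟨hQt, ?_, ?_, ?_⟩
  · rcases hor with hA | hB
    · exact le_max_of_le_left ((hWV t ht hT).trans ((hAV t ht hA).trans hVz))
    · exact le_max_of_le_right ((hWV t ht hT).trans (hB t le_rfl hT))
  · intro hTt
    rcases hor with ⟨-, a2, a3⟩ | hB
    · exfalso
      rw [div_lt_iff₀ hmm0] at hTt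
      have h1 := mul_nonneg hp0.le a2
      have h2 := hV0 (x t)
      nlinarith
    · exact (hWV t ht hT).trans (hB t le_rfl hT)
  · rcases hor with ⟨-, a2, a3⟩ | hB
    · right
      have h2 := hV0 (x t)
      have h3 : 0 ≤ mm / 2 * t := by positivity
      linarith
    · left
      intro s hs hsT
      exact (hWV s (ht.trans hs) hsT).trans (hB s hs hsT)

/-- The target is nonempty. -/
theorem aux_nonempty {n m : ℕ} (C : Set (Euc n)) (U : Set (Euc m))
    (f : Euc n → Euc m → Euc n) (l : Euc n → Euc m → ℝ)
    (p0 : ℝ) (W : Euc n → ℝ) (hH1 : HypH1 C U f l) (hp0 : 0 < p0)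
    (hWc : ContinuousOn W (closure Cᶜ)) (hWnn : ∀ x ∈ closure Cᶜ, 0 ≤ W x)
    (hWpr : ProperOn C W)
    (hdec : ∀ x, x ∉ C → ∀ p ∈ limitingSubdiff W x, Ham U f l p0 x p < 0) :
    C.Nonempty := by
  by_contra hne
  rw [Set.not_nonempty_iff_eq_empty] at hne
  have huniv : closure Cᶜ = Set.univ := by simp [hne]
  have hcomp := hWpr (Set.Icc 0 (W 0)) isCompact_Icc (fun y hy => hy.1)
  rw [huniv] at hcomp hWc hWnn
  have h0 : (0 : Euc n) ∈ Set.univ ∩ W ⁻¹' Set.Icc 0 (W 0) :=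
    ⟨trivial, hWnn 0 trivial, le_refl _⟩
  obtain ⟨xs, hxs, hmin⟩ := hcomp.exists_isMinOn ⟨0, h0⟩ (hWc.mono (Set.subset_univ _))
  have hglob : ∀ y, W xs ≤ W y := by
    intro y
    by_cases hy : W y ≤ W 0
    · exact hmin ⟨trivial, hWnn y trivial, hy⟩
    · exact le_trans hxs.2.2 (le_of_not_ge hy)
  have hp : (0 : Euc n) ∈ limitingSubdiff W xs := by
    refine ⟨fun _ => xs, fun _ => 0, fun k => ?_, tendsto_const_nhds, tendsto_const_nhds⟩
    refine ⟨1, one_pos, 1, one_pos, fun y _ => ?_⟩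
    rw [inner_zero_left]
    have := hglob y
    nlinarith [sq_nonneg ‖y - xs‖]
  have hlt := hdec xs (by simp [hne]) 0 hp
  have hge : 0 ≤ Ham U f l p0 xs 0 := by
    unfold Ham
    apply Real.sInf_nonneg
    rintro _ ⟨u, hu, rfl⟩
    have := hH1.2.2.2.1 xs u hu
    simp only [inner_zero_left, zero_add]
    positivity
  linarith

/-- The combined estimate on sampling trajectories. -/
def auxStrong {n m : ℕ} (C : Set (Euc n)) (U : Set (Euc m))
    (f : Euc n → Euc m → Euc n) (l : Euc n → Euc m → ℝ) (K : Euc n → Euc m)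
    (Z : Set (Euc n)) (p0 : ℝ) (W : Euc n → ℝ) (β : ℝ → ℝ → ℝ) : Prop :=
  ∀ r R : ℝ, 0 < r → r < R → ∃ δ > (0:ℝ),
      ∀ π : TimePartition, (∀ j, π.t (j+1) - π.t j ≤ δ) →
      ∀ z ∈ Z, dC C z ≤ R →
      ∀ x u T, IsSamplingSol C U f K π z x u T →
        (∀ t, 0 ≤ t → dC C (x t) ≤ max (β R t) r) ∧
        (∀ t, 0 ≤ t → (∃ s, t ≤ s ∧ r < dC C (x s)) →
          p0 * (∫ τ in (0:ℝ)..t, l (x τ) (u τ)) ≤ 2 * W z)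

/-- Sample stabilizability from the combined estimate. -/
theorem aux_sample {n m : ℕ} (C : Set (Euc n)) (U : Set (Euc m))
    (f : Euc n → Euc m → Euc n) (l : Euc n → Euc m → ℝ) (K : Euc n → Euc m)
    (Z : Set (Euc n)) (p0 : ℝ) (W : Euc n → ℝ) (β : ℝ → ℝ → ℝ) (hp0 : 0 < p0)
    (hZ : ∀ z ∈ Z, 0 < W z) (hβ : IsKL β) (h : auxStrong C U f l K Z p0 W β) :
    SampleStabOn C U f l K Z (p0 / 2) W := by
  refine ⟨β, hβ, fun r R hr hrR => ?_⟩
  obtain ⟨δ, hδ, hs⟩ := h r R hr hrR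
  refine ⟨δ, hδ, fun π hπ z hz hzR x u T hsol => ?_⟩
  obtain ⟨h1, h2⟩ := hs π hπ z hz hzR x u T hsol
  refine ⟨h1, ?_⟩
  have hW := hZ z hz
  have hpos : 0 ≤ W z / (p0 / 2) := by positivity
  have hb : ∀ t, 0 ≤ t → t < Tbar C x r →
      (∫ τ in (0:ℝ)..t, l (x τ) (u τ)) ≤ W z / (p0 / 2) := by
    intro t ht htT
    have hex : ∃ s, t ≤ s ∧ r < dC C (x s) := by
      by_contra hno
      push Not at hno
      have hle : ∀ e > 0, Tbar C x r ≤ t + e := by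
        intro e he
        apply csInf_le ⟨0, fun y hy => hy.1.le⟩
        exact ⟨by linarith, fun τ hτ => hno τ (by linarith)⟩
      have := le_of_forall_pos_le_add hle
      linarith
    have := h2 t ht hex
    rw [le_div_iff₀ (by positivity)]
    linarith
  have hT0 : 0 ≤ Tbar C x r := Real.sInf_nonneg (fun y hy => hy.1.le)
  rcases hT0.eq_or_lt with h0 | h0
  · rw [← h0]; simpa using hpos
  by_cases hi : IntervalIntegrable (fun τ => l (x τ) (u τ)) volume 0 (Tbar C x r)
  · have hc : ContinuousOn (fun t => ∫ τ in (0:ℝ)..t, l (x τ) (u τ))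
        (Set.uIcc 0 (Tbar C x r)) := by
      apply intervalIntegral.continuousOn_primitive_interval
      rw [Set.uIcc_of_le hT0]
      rw [intervalIntegrable_iff_integrableOn_Icc_of_le hT0] at hi
      exact hi
    rw [Set.uIcc_of_le hT0] at hc
    have ht := (hc (Tbar C x r) (Set.right_mem_Icc.2 hT0)).mono (Set.Ico_subset_Icc_self)
    have hne : (𝓝[Set.Ico 0 (Tbar C x r)] (Tbar C x r)).NeBot := by
      rw [← mem_closure_iff_nhdsWithin_neBot, closure_Ico h0.ne]
      exact Set.right_mem_Icc.2 hT0
    refine le_of_tendsto ht ?_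
    filter_upwards [self_mem_nhdsWithin] with t ht
    exact hb t ht.1 ht.2
  · rw [intervalIntegral.integral_undef hi]; exact hpos

/-- Euler stabilizability from the combined estimate. -/
theorem aux_euler {n m : ℕ} (C : Set (Euc n)) (U : Set (Euc m))
    (f : Euc n → Euc m → Euc n) (l : Euc n → Euc m → ℝ) (K : Euc n → Euc m)
    (Z : Set (Euc n)) (p0 : ℝ) (W : Euc n → ℝ) (β : ℝ → ℝ → ℝ) (hp0 : 0 < p0)
    (hCc : IsClosed C) (hCne : C.Nonempty)
    (hZ : ∀ z ∈ Z, z ∉ C) (hβ : IsKL β) (h : auxStrong C U f l K Z p0 W β) :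
    EulerStabOn C U f l K Z (p0 / 2) W := by
  have hdpos : ∀ y, y ∉ C → 0 < dC C y := fun y hy =>
    (hCc.notMem_iff_infDist_pos hCne).1 hy
  have hdcont : Continuous (dC C) := Metric.continuous_infDist_pt C
  refine ⟨β, hβ, fun z hz => ⟨?_, ?_⟩⟩
  · rintro X ⟨π, x, u, T, δ, hδ, hπ, hsol, hX⟩ t ht
    have hR := hdpos z (hZ z hz)
    have hlim : Tendsto (fun i => dC C (x i t)) atTop (𝓝 (dC C (X t))) :=
      (hdcont.tendsto _).comp (hX.tendsto_at (Set.mem_Ici.2 ht))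
    have hr : ∀ r, 0 < r → r < dC C z → dC C (X t) ≤ max (β (dC C z) t) r := by
      intro r hr hrR
      obtain ⟨δ0, hδ0, hs⟩ := h r _ hr hrR
      refine le_of_tendsto hlim ?_
      filter_upwards [hδ.eventually_lt_const hδ0] with i hi
      exact (hs (π i) (fun j => (hπ i j).trans hi.le) z hz le_rfl _ _ _ (hsol i)).1 t ht
    have hβ0 := hβ.nonneg (dC C z) t hR.le ht
    by_contra hlt
    push Not at hlt
    set r := min (dC C (X t)) (dC C z) / 2 with hrdef
    have hm : 0 < min (dC C (X t)) (dC C z) := lt_min (by linarith) hR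
    have h1 : min (dC C (X t)) (dC C z) ≤ dC C (X t) := min_le_left _ _
    have h2 : min (dC C (X t)) (dC C z) ≤ dC C z := min_le_right _ _
    have := hr r (by linarith) (by linarith)
    rcases le_max_iff.1 this with h3 | h3 <;> linarith
  · rintro X X0 ⟨π, x, u, T, δ, hδ, hπ, hsol, hX, hX0⟩ t ht htT
    have hR := hdpos z (hZ z hz)
    have hXc : ContinuousOn X (Set.Ici 0) :=
      hX.continuousOn (Frequently.of_forall fun i => (hsol i).cont)
    have hXz : X 0 = z := by
      have h1 := hX.tendsto_at (Set.mem_Ici.2 (le_refl (0:ℝ)))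
      have h2 : (fun i => x i 0) = fun _ => z := funext fun i => (hsol i).init
      rw [h2] at h1
      exact tendsto_nhds_unique h1 tendsto_const_nhds
    have hXt : X t ∉ C := by
      intro hXC
      set A : Set ℝ := Set.Icc 0 t ∩ X ⁻¹' C with hA
      have hAc : IsClosed A :=
        (hXc.mono Set.Icc_subset_Ici_self).preimage_isClosed_of_isClosed isClosed_Icc hCc
      have hAcomp : IsCompact A := isCompact_Icc.of_isClosed_subset hAc Set.inter_subset_left
      obtain ⟨s, hsA, hsmin⟩ := hAcomp.exists_isLeast ⟨t, ⟨ht, le_rfl⟩, hXC⟩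
      have hs0 : 0 < s := by
        rcases hsA.1.1.eq_or_lt with h0 | h0
        · exfalso
          have := hsA.2
          rw [← h0, Set.mem_preimage, hXz] at this
          exact hZ z hz this
        · exact h0
      have hle : exitTimeInf C X ≤ ENNReal.ofReal s := by
        apply sInf_le
        refine ⟨by simpa using hs0, ?_, ?_⟩
        · intro τ hτ0 hτs hτC
          have hlt : τ < s := (ENNReal.ofReal_lt_ofReal_iff hs0).1 hτs
          have := hsmin ⟨⟨hτ0, hlt.le.trans hsA.1.2⟩, hτC⟩
          linarith
        · unfold leftFilter
          rw [if_neg ENNReal.ofReal_ne_top, ENNReal.toReal_ofReal hs0.le]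
          have hc : ContinuousAt X s := hXc.continuousAt (Ici_mem_nhds hs0)
          have h1 : Tendsto (fun t => dC C (X t)) (𝓝 s) (𝓝 (dC C (X s))) :=
            (hdcont.tendsto _).comp hc
          have h2 : dC C (X s) = 0 := Metric.infDist_zero_of_mem hsA.2
          rw [h2] at h1
          exact h1.mono_left nhdsWithin_le_nhds
      have : ENNReal.ofReal s ≤ ENNReal.ofReal t := ENNReal.ofReal_le_ofReal hsA.1.2
      exact absurd htT (not_lt.2 (hle.trans this))
    have hd := hdpos _ hXt
    have hm : 0 < min (dC C (X t)) (dC C z) := lt_min hd hR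
    have h1 : min (dC C (X t)) (dC C z) ≤ dC C (X t) := min_le_left _ _
    have h2 : min (dC C (X t)) (dC C z) ≤ dC C z := min_le_right _ _
    obtain ⟨δ0, hδ0, hs⟩ := h (min (dC C (X t)) (dC C z) / 2) (dC C z)
      (by linarith) (by linarith)
    have hlim : Tendsto (fun i => dC C (x i t)) atTop (𝓝 (dC C (X t))) :=
      (hdcont.tendsto _).comp (hX.tendsto_at (Set.mem_Ici.2 ht))
    refine le_of_tendsto (hX0.tendsto_at (Set.mem_Ici.2 ht)) ?_
    filter_upwards [hδ.eventually_lt_const hδ0,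
      hlim.eventually_const_lt (show min (dC C (X t)) (dC C z) / 2 < dC C (X t) by linarith)]
      with i hi hi2
    have := (hs (π i) (fun j => (hπ i j).trans hi.le) z hz le_rfl _ _ _ (hsol i)).2 t ht
      ⟨t, le_rfl, hi2⟩
    rw [le_div_iff₀ (by positivity)]
    linarith

/-- The combined estimate from the level estimates. -/
theorem aux_strong {n m : ℕ} (C : Set (Euc n)) (U : Set (Euc m))
    (f : Euc n → Euc m → Euc n) (l : Euc n → Euc m → ℝ) (K : Euc n → Euc m)
    (Z : Set (Euc n)) (p0 : ℝ) (W : Euc n → ℝ) (Q : Set (Euc n)) (σ L D : ℝ)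
    (hσ : 0 < σ) (hL0 : 0 < L) (hD0 : 0 ≤ D)
    (hZ : ∀ z ∈ Z, z ∉ C ∧ W z ≤ σ)
    (hD : ∀ x ∈ Q, dC C x ≤ D)
    (hdW : ∀ ε : ℝ, 0 < ε → ∃ c : ℝ, 0 ≤ c ∧ ∀ x ∈ Q, dC C x ≤ ε + c * W x)
    (hWd : ∀ z ∈ Z, W z ≤ L * dC C z)
    (hlev : ∀ ν : ℝ, 0 < ν → 4 * ν ≤ 2 * σ →
      ∃ δ > (0 : ℝ), ∃ Tν : ℝ, 0 ≤ Tν ∧ ∀ π : TimePartition, (∀ j, π.t (j+1) - π.t j ≤ δ) →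
      ∀ z, z ∉ C → W z ≤ σ → ∀ x u T, IsSamplingSol C U f K π z x u T →
        ∀ t, 0 ≤ t → ENNReal.ofReal t < T →
          x t ∈ Q ∧ W (x t) ≤ max (2 * W z) (4 * ν) ∧ (Tν < t → W (x t) ≤ 4 * ν) ∧
          ((∀ s, t ≤ s → ENNReal.ofReal s < T → W (x s) ≤ 4 * ν) ∨
            p0 * (∫ τ in (0:ℝ)..t, l (x τ) (u τ)) ≤ 2 * W z)) :
    ∃ β, IsKL β ∧ auxStrong C U f l K Z p0 W β := by
  have hk : ∀ k : ℕ, (0:ℝ) < 1 / (2 * ((k:ℝ) + 1)) := fun k => by positivity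
  choose c hc0 hc using fun k : ℕ => hdW _ (hk k)
  have hνex : ∀ k : ℕ, ∃ ν : ℝ, 0 < ν ∧ 4 * ν ≤ 2 * σ ∧
      ∀ x ∈ Q, W x ≤ 4 * ν → dC C x ≤ 1 / ((k:ℝ) + 1) := by
    intro k
    have hck : 0 < c k + 1 := by linarith [hc0 k]
    refine ⟨min (σ / 2) (1 / (2 * ((k:ℝ) + 1)) / (c k + 1) / 4), ?_, ?_, ?_⟩
    · have := hk k
      exact lt_min (by positivity) (by positivity)
    · linarith [min_le_left (σ / 2) (1 / (2 * ((k:ℝ) + 1)) / (c k + 1) / 4)]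
    · intro x hx hW
      have h1 := hc k x hx
      have h2 : W x ≤ 1 / (2 * ((k:ℝ) + 1)) / (c k + 1) := by
        linarith [min_le_right (σ / 2) (1 / (2 * ((k:ℝ) + 1)) / (c k + 1) / 4)]
      have h3 : c k * W x ≤ 1 / (2 * ((k:ℝ) + 1)) := by
        calc c k * W x ≤ c k * (1 / (2 * ((k:ℝ) + 1)) / (c k + 1)) :=
              mul_le_mul_of_nonneg_left h2 (hc0 k)
          _ ≤ (c k + 1) * (1 / (2 * ((k:ℝ) + 1)) / (c k + 1)) := by
              apply mul_le_mul_of_nonneg_right (by linarith)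
              have := hk k
              positivity
          _ = 1 / (2 * ((k:ℝ) + 1)) := by field_simp
      have h4 : 1 / (2 * ((k:ℝ) + 1)) + 1 / (2 * ((k:ℝ) + 1)) = 1 / ((k:ℝ) + 1) := by
        field_simp; norm_num
      linarith
  choose ν hν0 hνσ hνd using hνex
  choose δ hδ0 Tk hTk hmain using fun k => hlev (ν k) (hν0 k) (hνσ k)
  have hTsle : ∀ i k, i ≤ k → Tk i ≤ ∑ j ∈ Finset.range (k + 1), Tk j := by
    intro i k hik
    exact Finset.single_le_sum (f := Tk) (fun j _ => hTk j)
      (Finset.mem_range.2 (Nat.lt_succ_of_le hik))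
  obtain ⟨β, hβ, hβm⟩ := aux_KL (fun k => 2 * L * c k)
    (fun k => ∑ j ∈ Finset.range (k + 1), Tk j) D
    (fun k => by have := hc0 k; positivity) hD0
  refine ⟨β, hβ, fun r R hr hrR => ?_⟩
  obtain ⟨k0, hk0⟩ := exists_nat_one_div_lt hr
  have hδex : ∃ δ' > (0:ℝ), ∀ k ≤ k0, δ' ≤ δ k := by
    refine ⟨(Finset.range (k0 + 1)).inf' ⟨0, by simp⟩ δ, ?_, ?_⟩
    · exact (Finset.lt_inf'_iff _).2 fun i _ => hδ0 i
    · intro k hk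
      exact Finset.inf'_le _ (Finset.mem_range.2 (Nat.lt_succ_of_le hk))
  obtain ⟨δ', hδ', hδle⟩ := hδex
  refine ⟨δ', hδ', fun π hπ z hz hzR x u T hsol => ?_⟩
  have hm : ∀ k ≤ k0, ∀ t, 0 ≤ t → ENNReal.ofReal t < T → _ := fun k hk =>
    hmain k π (fun j => (hπ j).trans (hδle k hk)) z (hZ z hz).1 (hZ z hz).2 x u T hsol
  have hout : ∀ t, 0 ≤ t → ¬ ENNReal.ofReal t < T → dC C (x t) = 0 := by
    intro t ht hnt
    have hTle := not_lt.1 hnt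
    have hTt : T ≠ ⊤ := ne_top_of_le_ne_top ENNReal.ofReal_ne_top hTle
    have hTe : T = ENNReal.ofReal T.toReal := (ENNReal.ofReal_toReal hTt).symm
    obtain ⟨h1, h2⟩ := hsol.exit T.toReal ENNReal.toReal_nonneg hTe
    have h3 : T.toReal ≤ t := by
      rw [hTe] at hTle
      exact (ENNReal.ofReal_le_ofReal_iff ht).1 hTle
    rw [h2 t h3, h1]
  have hfar : ∀ t, 0 ≤ t → r < dC C (x t) → ENNReal.ofReal t < T := by
    intro t ht hd
    by_contra hno
    have := hout t ht hno
    linarith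
  refine ⟨fun t ht => ?_, ?_⟩
  · by_cases hd : dC C (x t) ≤ r
    · exact le_max_of_le_right hd
    push Not at hd
    have htT := hfar t ht hd
    apply le_max_of_le_left
    obtain ⟨hQ, hmax, hlate, -⟩ := hm k0 le_rfl t ht htT
    have hW4 : ¬ W (x t) ≤ 4 * ν k0 := fun hle => by
      have := hνd k0 _ hQ hle
      linarith
    have hWz : W (x t) ≤ 2 * W z := by
      rcases le_max_iff.1 hmax with h1 | h1
      · exact h1
      · exact absurd h1 hW4
    have hWR : W (x t) ≤ 2 * L * R := by
      have h1 := hWd z hz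
      have h2 := mul_le_mul_of_nonneg_left hzR hL0.le
      linarith
    refine hβm R t _ (by linarith) ht Metric.infDist_nonneg (hD _ hQ) ?_ ?_
    · intro k
      have h1 := hc k _ hQ
      have h2 := mul_le_mul_of_nonneg_left hWR (hc0 k)
      have h3 : 1 / (2 * ((k:ℝ) + 1)) ≤ 1 / ((k:ℝ) + 1) := by
        apply one_div_le_one_div_of_le <;> linarith [Nat.cast_nonneg (α := ℝ) k]
      have h4 : 2 * L * c k * R = c k * (2 * L * R) := by ring
      simp only [h4]
      linarith
    · intro k hkt
      rcases le_total k k0 with hkk | hkk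
      · obtain ⟨-, -, hl, -⟩ := hm k hkk t ht htT
        exact hνd k _ hQ (hl ((hTsle k k le_rfl).trans_lt hkt))
      · exact absurd (hlate ((hTsle k0 k hkk).trans_lt hkt)) hW4
  · rintro t ht ⟨s, hts, hs⟩
    have hsT := hfar s (ht.trans hts) hs
    have htT : ENNReal.ofReal t < T := (ENNReal.ofReal_le_ofReal hts).trans_lt hsT
    obtain ⟨-, -, -, h4⟩ := hm k0 le_rfl t ht htT
    rcases h4 with h4 | h4
    · exfalso
      have hQs := (hm k0 le_rfl s (ht.trans hts) hsT).1
      have := hνd k0 _ hQs (h4 s hts hsT)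
      linarith
    · exact h4

/-- Main theorem. -/
theorem aux_main
    {n m : ℕ} (C : Set (Euc n)) (U : Set (Euc m))
    (f : Euc n → Euc m → Euc n) (l : Euc n → Euc m → ℝ)
    (p0 : ℝ) (W : Euc n → ℝ)
    (hH1 : HypH1 C U f l) (hp0 : 0 < p0)
    (hWc : ContinuousOn W (closure Cᶜ)) (hWnn : ∀ x ∈ closure Cᶜ, 0 ≤ W x)
    (hWlip : LocLipschitzOn (closure Cᶜ) W)
    (hWpd : PosDefOn C W) (hWpr : ProperOn C W)
    (hdec : ∀ x, x ∉ C → ∀ p ∈ limitingSubdiff W x, Ham U f l p0 x p < 0) :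
    ∀ σ : ℝ, 0 < σ → ∃ K : Euc n → Euc m,
      (∀ x, x ∉ C → 0 < W x → W x ≤ σ → K x ∈ U) ∧
      (∀ x, x ∉ C → 0 < W x → W x ≤ σ →
        ∃ V ∈ 𝓝 x, Bornology.IsBounded (K '' (V \ C))) ∧
      SampleStabOn C U f l K {z | z ∉ C ∧ 0 < W z ∧ W z ≤ σ} (p0 / 2) W ∧
      EulerStabOn C U f l K {z | z ∉ C ∧ 0 < W z ∧ W z ≤ σ} (p0 / 2) W := by
  intro σ hσ
  have hCne := aux_nonempty C U f l p0 W hH1 hp0 hWc hWnn hWpr hdec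
  have hCc : IsClosed C := hH1.1
  set Q : Set (Euc n) := closure Cᶜ ∩ W ⁻¹' Set.Icc 0 (2 * σ + 1) with hQdef
  have hQc : IsCompact Q := hWpr _ isCompact_Icc (fun y hy => hy.1)
  obtain ⟨ρ, hρ⟩ := hQc.isBounded.subset_closedBall 0
  set Kc : Set (Euc n) := closure Cᶜ ∩ closedBall 0 (ρ + 1) with hKc
  have hKcc : IsCompact Kc := (isCompact_closedBall 0 (ρ + 1)).inter_left isClosed_closure
  have hQsub : Q ⊆ Kc := fun x hx => ⟨hx.1, closedBall_subset_closedBall (by linarith) (hρ hx)⟩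
  have hQK : ∀ x ∈ Q, ∀ y, y ∉ C → ‖y - x‖ ≤ 1 → y ∈ Kc := by
    intro x hx y hy hyx
    refine ⟨subset_closure hy, ?_⟩
    have h1 := hρ hx
    rw [mem_closedBall_zero_iff] at h1 ⊢
    have := norm_add_le (y - x) x
    rw [sub_add_cancel] at this
    linarith
  obtain ⟨M, Ml, Lf, Ll, hM, hMl, hLf0, hLl0, hbd, hlip⟩ :=
    hH1.2.2.2.2.2.2 Kc hKcc Set.inter_subset_left
  have hWl : LocallyLipschitzOn Kc W := by
    intro x hx
    obtain ⟨k, t, ht, hk⟩ := hWlip x hx.1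
    exact ⟨k, t, nhdsWithin_mono x Set.inter_subset_left ht, hk⟩
  obtain ⟨k, hk⟩ := hWl.exists_lipschitzOnWith_of_compact hKcc
  obtain ⟨L, hL0, hL⟩ : ∃ L : ℝ, 0 < L ∧ ∀ x ∈ Kc, ∀ y ∈ Kc, W x - W y ≤ L * ‖x - y‖ := by
    refine ⟨k + 1, by positivity, fun x hx y hy => ?_⟩
    have h1 := hk.dist_le_mul x hx y hy
    rw [Real.dist_eq, dist_eq_norm] at h1
    have h2 := le_abs_self (W x - W y)
    nlinarith [norm_nonneg (x - y)]
  obtain ⟨V, K, hV0, hVW, hVK⟩ := aux_lyap C U f l p0 W hH1 hp0 hWc hWpd hWpr hdec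
    (2 * σ + 1) L Lf Ll (by linarith) hL0 hLf0 hLl0 Q hQdef
    (fun x hx y hy => hL x (hQsub hx) y (hQsub hy))
    (fun x hx y hy u hu => (hlip x (hQsub hx) y (hQsub hy) u hu).1)
    (fun x hx y hy u hu => (hlip x (hQsub hx) y (hQsub hy) u hu).2)
  have hlev := aux_level C U f l p0 W hH1 hp0 hWpd σ L Lf Ll M hσ hL0 hLf0 hLl0 hM Q Kc hQdef
    hQK hL (fun y hy u hu => (hbd y hy u hu).1)
    (fun x hx y hy u hu => (hlip x hx y hy u hu).1)
    (fun x hx y hy u hu => (hlip x hx y hy u hu).2) V K hV0 hVW hVK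
  have hdcont : Continuous (dC C) := Metric.continuous_infDist_pt C
  obtain ⟨D, hD⟩ := hQc.bddAbove_image hdcont.continuousOn
  have hD' : ∀ x ∈ Q, dC C x ≤ max D 0 := fun x hx =>
    le_max_of_le_left (hD (Set.mem_image_of_mem _ hx))
  have hdW : ∀ ε : ℝ, 0 < ε → ∃ c : ℝ, 0 ≤ c ∧ ∀ x ∈ Q, dC C x ≤ ε + c * W x := by
    intro ε hε
    have hAc : IsCompact (Q ∩ {x | ε ≤ dC C x}) :=
      hQc.inter_right (isClosed_le continuous_const hdcont)
    rcases (Q ∩ {x | ε ≤ dC C x}).eq_empty_or_nonempty with hem | hne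
    · refine ⟨0, le_rfl, fun x hx => ?_⟩
      by_contra hlt
      push Not at hlt
      have : x ∈ Q ∩ {x | ε ≤ dC C x} := ⟨hx, (show ε ≤ dC C x by linarith)⟩
      rw [hem] at this
      exact this
    · obtain ⟨y, hy, hmin⟩ := hAc.exists_isMinOn hne
        (hWc.mono (fun x hx => hx.1.1))
      have hyC : y ∉ C := by
        intro hyC
        have h1 : dC C y = 0 := Metric.infDist_zero_of_mem hyC
        have h2 : ε ≤ dC C y := hy.2
        linarith
      have hWy := hWpd.1 y hyC
      refine ⟨max D 0 / W y, by positivity, fun x hx => ?_⟩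
      have hWx : 0 ≤ W x := hWnn x hx.1
      by_cases hd : ε ≤ dC C x
      · have h1 : W y ≤ W x := hmin ⟨hx, hd⟩
        have h2 : max D 0 ≤ max D 0 / W y * W x := by
          rw [div_mul_eq_mul_div, le_div_iff₀ hWy]
          exact mul_le_mul_of_nonneg_left h1 (le_max_right _ _)
        linarith [hD' x hx]
      · push Not at hd
        have : 0 ≤ max D 0 / W y * W x := by positivity
        linarith
  have hWd : ∀ z ∈ {z | z ∉ C ∧ 0 < W z ∧ W z ≤ σ}, W z ≤ L * dC C z := by
    rintro z ⟨hzC, hz0, hzσ⟩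
    obtain ⟨y, hyf, hy⟩ := exists_mem_frontier_infDist_compl_eq_dist (s := Cᶜ) hzC (by
      intro hu
      obtain ⟨w, hw⟩ := hCne
      have : w ∈ Cᶜ := by rw [hu]; trivial
      exact this hw)
    rw [compl_compl] at hy
    have hycl : y ∈ closure Cᶜ := frontier_subset_closure hyf
    rw [frontier_compl] at hyf
    have hWy := hWpd.2 y hyf
    have hyQ : y ∈ Q := ⟨hycl, by simp only [Set.mem_preimage, hWy]; constructor <;> linarith⟩
    have hzQ : z ∈ Q := ⟨subset_closure hzC, ⟨hz0.le, by linarith⟩⟩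
    have h1 := hL z (hQsub hzQ) y (hQsub hyQ)
    rw [hWy, sub_zero, ← dist_eq_norm, ← hy] at h1
    exact h1
  obtain ⟨β, hβ, hstr⟩ := aux_strong C U f l K {z | z ∉ C ∧ 0 < W z ∧ W z ≤ σ} p0 W Q σ L
    (max D 0) hσ hL0 (le_max_right _ _) (fun z hz => ⟨hz.1, hz.2.2⟩) hD' hdW hWd hlev
  refine ⟨K, ?_, ?_, aux_sample C U f l K _ p0 W β hp0 (fun z hz => hz.2.1) hβ hstr,
    aux_euler C U f l K _ p0 W β hp0 hCc hCne (fun z hz => hz.1) hβ hstr⟩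
  · intro x hx hx0 hxσ
    obtain ⟨N, hN, Λ, hΛ, h⟩ := hVK (W x) hx0
    exact (h x ⟨subset_closure hx, hx0.le, by linarith⟩ le_rfl (by linarith)).1
  · intro x hx hx0 hxσ
    obtain ⟨N, hN, Λ, hΛ, h⟩ := hVK (W x / 2) (by linarith)
    have hcx : ContinuousAt W x := hWc.continuousAt
      (Filter.mem_of_superset (hCc.isOpen_compl.mem_nhds hx) subset_closure)
    refine ⟨W ⁻¹' Set.Ioo (W x / 2) (2 * σ + 1),
      hcx (Ioo_mem_nhds (by linarith) (by linarith)), ?_⟩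
    refine (Metric.isBounded_closedBall (x := (0 : Euc m)) (r := N)).subset ?_
    rintro _ ⟨y, ⟨hyW, hyC⟩, rfl⟩
    rw [mem_closedBall_zero_iff]
    have hy1 : W x / 2 < W y := hyW.1
    have hy2 : W y < 2 * σ + 1 := hyW.2
    exact (h y ⟨subset_closure hyC, by constructor <;> linarith⟩ hy1.le hy2).2.1

/-- Corollary 4.10: under (H1), a Lipschitz continuous `p₀`-OMRF with `p₀ > 0`
yields, for every `σ > 0`, a locally bounded feedback on `W⁻¹((0,σ])` that sample and
Euler stabilizes the system to `C` with `(p₀/2, W)`-regulated cost for initial points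
in `W⁻¹((0,σ])`. -/
theorem lipschitz_omrf_implies_stabilizability_on_sublevel_sets
    {n m : ℕ} (C : Set (Euc n)) (U : Set (Euc m))
    (f : Euc n → Euc m → Euc n) (l : Euc n → Euc m → ℝ)
    (p0 : ℝ) (W : Euc n → ℝ)
    (hH1 : HypH1 C U f l) (hp0 : 0 < p0)
    (hWc : ContinuousOn W (closure Cᶜ)) (hWnn : ∀ x ∈ closure Cᶜ, 0 ≤ W x)
    (hWlip : LocLipschitzOn (closure Cᶜ) W)
    (hWpd : PosDefOn C W) (hWpr : ProperOn C W)
    (hdec : ∀ x, x ∉ C → ∀ p ∈ limitingSubdiff W x, Ham U f l p0 x p < 0) :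
    ∀ σ : ℝ, 0 < σ → ∃ K : Euc n → Euc m,
      (∀ x, x ∉ C → 0 < W x → W x ≤ σ → K x ∈ U) ∧
      (∀ x, x ∉ C → 0 < W x → W x ≤ σ →
        ∃ V ∈ 𝓝 x, Bornology.IsBounded (K '' (V \ C))) ∧
      SampleStabOn C U f l K {z | z ∉ C ∧ 0 < W z ∧ W z ≤ σ} (p0 / 2) W ∧
      EulerStabOn C U f l K {z | z ∉ C ∧ 0 < W z ∧ W z ≤ σ} (p0 / 2) W := by
  exact aux_main C U f l p0 W hH1 hp0 hWc hWnn hWlip hWpd hWpr hdec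
end

section
/- Consider the nonholonomic integrator: n = 3, U := {u ∈ ℝ² : u₁² + u₂² ≤ 1}, C := {0} ⊂ ℝ³, f(x,u) := (u₁, u₂, x₁u₂ − x₂u₁). Let l : (ℝ³ ∖ {0})×U → [0,∞) be a continuous Lagrangian and suppose there is C > 0 such that 0 ≤ l(x,u) ≤ C·√(V(x)) for all (x,u) ∈ (ℝ³ ∖ {0})×U, where V(x) := (√(x₁²+x₂²) − |x₃|)² + (√(x₁²+x₂²) − 2|x₃|)²(x₁²+x₂²). Then for every p₀ ∈ (0, 1/C) the function W₁(x) := (√(x₁²+x₂²) − |x₃|)² + x₃² is a p₀-Minimum Restraint Function; in particular W₁ is continuous on ℝ³, locally semiconcave, positive definite and proper on ℝ³ ∖ {0}, and H(x, p₀, p) ≤ −(1 − p₀C)·√(V(x)) for every x ∈ ℝ³ ∖ {0} and every p ∈ D*W₁(x). -/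
open Filter Topology Metric MeasureTheory Bornology
open scoped RealInnerProductSpace ENNReal NNReal

/-- Cylindrical radius squared facts: the explicit function. -/
lemma euc3_norm_sq (x : Euc 3) : ‖x‖ ^ 2 = x 0 ^ 2 + x 1 ^ 2 + x 2 ^ 2 := by
  rw [EuclideanSpace.norm_sq_eq, Fin.sum_univ_three]
  simp

lemma euc2_norm_sq (x : Euc 2) : ‖x‖ ^ 2 = x 0 ^ 2 + x 1 ^ 2 := by
  rw [EuclideanSpace.norm_sq_eq, Fin.sum_univ_two]
  simp

lemma euc3_inner (p y : Euc 3) : ⟪p, y⟫ = p 0 * y 0 + p 1 * y 1 + p 2 * y 2 := by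
  rw [PiLp.inner_apply, Fin.sum_univ_three]
  simp [mul_comm]

lemma W1_lower (x : Euc 3) : ‖x‖ ^ 2 ≤
    3 * ((Real.sqrt (x 0 ^ 2 + x 1 ^ 2) - |x 2|) ^ 2 + (x 2) ^ 2) := by
  have h0 : 0 ≤ x 0 ^ 2 + x 1 ^ 2 := by positivity
  have h1 := Real.sq_sqrt h0
  have h2 := sq_abs (x 2)
  rw [euc3_norm_sq]
  nlinarith [sq_nonneg (Real.sqrt (x 0 ^ 2 + x 1 ^ 2) - 2 * |x 2|)]

lemma sqrt_tri (a b c d : ℝ) :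
    2 * Real.sqrt (((a + c) / 2) ^ 2 + ((b + d) / 2) ^ 2) ≤
      Real.sqrt (a ^ 2 + b ^ 2) + Real.sqrt (c ^ 2 + d ^ 2) := by
  have h := norm_add_le (!₂[a, b] : Euc 2) !₂[c, d]
  simp only [EuclideanSpace.norm_eq, Fin.sum_univ_two] at h
  simp at h
  have : 2 * Real.sqrt (((a + c) / 2) ^ 2 + ((b + d) / 2) ^ 2) =
      Real.sqrt ((a + c) ^ 2 + (b + d) ^ 2) := by
    rw [show (a + c) ^ 2 + (b + d) ^ 2 = 2 ^ 2 * (((a + c) / 2) ^ 2 + ((b + d) / 2) ^ 2) by ring,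
      Real.sqrt_mul (by norm_num), Real.sqrt_sq (by norm_num)]
  rw [this]; exact h

lemma sqrt_rev (a b c d : ℝ) :
    (Real.sqrt (a ^ 2 + b ^ 2) - Real.sqrt (c ^ 2 + d ^ 2)) ^ 2 ≤ (a - c) ^ 2 + (b - d) ^ 2 := by
  have h := abs_norm_sub_norm_le (!₂[a, b] : Euc 2) !₂[c, d]
  have h2 := euc2_norm_sq ((!₂[a, b] : Euc 2) - !₂[c, d])
  simp only [EuclideanSpace.norm_eq !₂[a, b], EuclideanSpace.norm_eq !₂[c, d],
    Fin.sum_univ_two] at h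
  simp at h h2
  rw [← h2]
  exact sq_le_sq' (by linarith [(abs_le.1 h).1]) (abs_le.1 h).2

lemma semiconc_aux (a b c d z w : ℝ) :
    ((Real.sqrt (a ^ 2 + b ^ 2) - |z|) ^ 2 + z ^ 2) +
    ((Real.sqrt (c ^ 2 + d ^ 2) - |w|) ^ 2 + w ^ 2) -
    2 * ((Real.sqrt (((a + c) / 2) ^ 2 + ((b + d) / 2) ^ 2) - |(z + w) / 2|) ^ 2
      + ((z + w) / 2) ^ 2) ≤ 2 * ((a - c) ^ 2 + (b - d) ^ 2 + (z - w) ^ 2) := by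
  have t1 := sqrt_tri a b c d
  have t2 := sqrt_rev a b c d
  have t3 : 2 * |(z + w) / 2| ≤ |z| + |w| := by
    rw [abs_div, abs_two]; linarith [abs_add_le z w]
  have t4 : (|z| - |w|) ^ 2 ≤ (z - w) ^ 2 := by
    have := abs_abs_sub_abs_le_abs_sub z w
    exact sq_le_sq.2 this
  have s1 := Real.sq_sqrt (show 0 ≤ a ^ 2 + b ^ 2 by positivity)
  have s2 := Real.sq_sqrt (show 0 ≤ c ^ 2 + d ^ 2 by positivity)
  have s3 := Real.sq_sqrt (show 0 ≤ ((a + c) / 2) ^ 2 + ((b + d) / 2) ^ 2 by positivity)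
  have n1 := Real.sqrt_nonneg (a ^ 2 + b ^ 2)
  have n2 := Real.sqrt_nonneg (c ^ 2 + d ^ 2)
  have n3 := Real.sqrt_nonneg (((a + c) / 2) ^ 2 + ((b + d) / 2) ^ 2)
  have z1 := sq_abs z
  have z2 := sq_abs w
  have z3 := sq_abs ((z + w) / 2)
  have n4 := abs_nonneg ((z + w) / 2)
  generalize Real.sqrt (a ^ 2 + b ^ 2) = A at *
  generalize Real.sqrt (c ^ 2 + d ^ 2) = B at *
  generalize Real.sqrt (((a + c) / 2) ^ 2 + ((b + d) / 2) ^ 2) = M at *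
  generalize |(z + w) / 2| = Z at *
  have hp : (2 * M) * (2 * Z) ≤ (A + B) * (|z| + |w|) :=
    mul_le_mul t1 t3 (by positivity) (by positivity)
  nlinarith [sq_nonneg ((A - B) + (|z| - |w|)), sq_nonneg (a - c), sq_nonneg (b - d),
    sq_nonneg (z - w)]

/-- A function `c₀ + c₁|t| + c₂t²` with `c₁ ≠ 0` is not differentiable at `0`. -/
lemma not_diff_aux (c0 c1 c2 : ℝ) (hc : c1 ≠ 0) :
    ¬ DifferentiableAt ℝ (fun t : ℝ => c0 + c1 * |t| + c2 * t ^ 2) 0 := by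
  intro h
  apply not_differentiableAt_abs_zero
  have h2 : DifferentiableAt ℝ
      (fun t : ℝ => c1⁻¹ * ((c0 + c1 * |t| + c2 * t ^ 2) - (c0 + c2 * t ^ 2))) 0 :=
    (h.sub (by fun_prop)).const_mul _
  convert h2 using 2 with t
  field_simp
  ring

lemma line_deriv (W : Euc 3 → ℝ) (x d : Euc 3) (h : DifferentiableAt ℝ W x) :
    HasDerivAt (fun t : ℝ => W (x + t • d)) ⟪gradient W x, d⟫ 0 := by
  have hg : HasGradientAt W (gradient W x) x := h.hasGradientAt
  have hf := hg.hasFDerivAt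
  have hl : HasDerivAt (fun t : ℝ => x + t • d) d 0 := by
    simpa using ((hasDerivAt_id (0 : ℝ)).smul_const d).const_add x
  have h3 : HasFDerivAt W ((InnerProductSpace.toDual ℝ (Euc 3)) (gradient W x))
      (x + (0 : ℝ) • d) := by simpa using hf
  have h4 := h3.comp_hasDerivAt (0 : ℝ) hl
  exact h4

/-- The derivative of `W₁` along a line through a point with `r > 0` and `x₃ ≠ 0`. -/
lemma scalar_deriv (a b z α β ζ : ℝ) (hr : 0 < a ^ 2 + b ^ 2) (hz : z ≠ 0) :
    HasDerivAt (fun t : ℝ => (Real.sqrt ((a + t * α) ^ 2 + (b + t * β) ^ 2) - |z + t * ζ|) ^ 2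
      + (z + t * ζ) ^ 2)
      (2 * (Real.sqrt (a ^ 2 + b ^ 2) - |z|) *
        ((a * α + b * β) / Real.sqrt (a ^ 2 + b ^ 2) - SignType.sign z * ζ) + 2 * z * ζ) 0 := by
  have lin : ∀ p q : ℝ, HasDerivAt (fun t : ℝ => p + t * q) q 0 := fun p q => by
    simpa using ((hasDerivAt_id (0 : ℝ)).mul_const q).const_add p
  have h1 : HasDerivAt (fun t : ℝ => (a + t * α) ^ 2 + (b + t * β) ^ 2)
      (2 * (a * α + b * β)) 0 := by
    refine (((lin a α).pow 2).add ((lin b β).pow 2)).congr_deriv ?_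
    simp; ring
  have h2 := h1.sqrt (by simpa using hr.ne')
  have h3 : HasDerivAt (fun t : ℝ => |z + t * ζ|) (SignType.sign z * ζ) 0 := by
    have := hasDerivAt_abs (x := z + 0 * ζ) (by simpa using hz)
    refine (this.comp (0 : ℝ) (lin z ζ)).congr_deriv ?_
    simp
  refine (((h2.sub h3).pow 2).add ((lin z ζ).pow 2)).congr_deriv ?_
  have : Real.sqrt (a ^ 2 + b ^ 2) ≠ 0 := (Real.sqrt_pos.2 hr).ne'
  simp
  field_simp
  exact Or.inl trivial

/-- Key identity at differentiability points. -/
lemma grad_identity (W1 : Euc 3 → ℝ)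
    (hW1 : ∀ x : Euc 3, W1 x =
      (Real.sqrt (x 0 ^ 2 + x 1 ^ 2) - |x 2|) ^ 2 + (x 2) ^ 2)
    (x : Euc 3) (hx : x ≠ 0) (hd : DifferentiableAt ℝ W1 x) :
    (gradient W1 x 0 - x 1 * gradient W1 x 2) ^ 2 +
    (gradient W1 x 1 + x 0 * gradient W1 x 2) ^ 2 =
    4 * ((Real.sqrt (x 0 ^ 2 + x 1 ^ 2) - |x 2|) ^ 2 +
      (Real.sqrt (x 0 ^ 2 + x 1 ^ 2) - 2 * |x 2|) ^ 2 * (x 0 ^ 2 + x 1 ^ 2)) := by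
  have hnn : 0 ≤ x 0 ^ 2 + x 1 ^ 2 := by positivity
  have hpos : 0 < x 0 ^ 2 + x 1 ^ 2 + x 2 ^ 2 := by
    rw [← euc3_norm_sq]; have := norm_pos_iff.2 hx; positivity
  by_cases hr : x 0 ^ 2 + x 1 ^ 2 = 0
  · exfalso
    have e0 : x 0 = 0 := by nlinarith [sq_nonneg (x 0), sq_nonneg (x 1)]
    have e1 : x 1 = 0 := by nlinarith [sq_nonneg (x 0), sq_nonneg (x 1)]
    have hz : x 2 ≠ 0 := by
      intro h; rw [hr, h] at hpos; norm_num at hpos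
    have := (line_deriv W1 x !₂[1, 0, 0] hd).differentiableAt
    refine not_diff_aux (2 * x 2 ^ 2) (-2 * |x 2|) 1 (by simpa using hz) ?_
    refine this.congr_of_eventuallyEq (Eventually.of_forall fun t => ?_)
    simp only
    rw [hW1]
    simp [e0, e1, Real.sqrt_sq_eq_abs]
    nlinarith [sq_abs t, sq_abs (x 2)]
  have hr' : 0 < x 0 ^ 2 + x 1 ^ 2 := lt_of_le_of_ne hnn (Ne.symm hr)
  by_cases hz : x 2 = 0
  · exfalso
    have := (line_deriv W1 x !₂[0, 0, 1] hd).differentiableAt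
    refine not_diff_aux (x 0 ^ 2 + x 1 ^ 2) (-2 * Real.sqrt (x 0 ^ 2 + x 1 ^ 2)) 2
      (by simpa using (Real.sqrt_pos.2 hr').ne') ?_
    refine this.congr_of_eventuallyEq (Eventually.of_forall fun t => ?_)
    simp only
    rw [hW1]
    simp [hz]
    nlinarith [sq_abs t, Real.sq_sqrt hnn]
  have D : ∀ α β ζ : ℝ, gradient W1 x 0 * α + gradient W1 x 1 * β + gradient W1 x 2 * ζ =
      2 * (Real.sqrt (x 0 ^ 2 + x 1 ^ 2) - |x 2|) *
        ((x 0 * α + x 1 * β) / Real.sqrt (x 0 ^ 2 + x 1 ^ 2) - SignType.sign (x 2) * ζ)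
        + 2 * x 2 * ζ := by
    intro α β ζ
    have h1 := line_deriv W1 x !₂[α, β, ζ] hd
    rw [euc3_inner] at h1
    have h2 := scalar_deriv (x 0) (x 1) (x 2) α β ζ hr' hz
    have h3 : (fun t : ℝ => W1 (x + t • !₂[α, β, ζ])) = (fun t : ℝ =>
      (Real.sqrt ((x 0 + t * α) ^ 2 + (x 1 + t * β) ^ 2) - |x 2 + t * ζ|) ^ 2
      + (x 2 + t * ζ) ^ 2) := by
      funext t; rw [hW1]; simp
    rw [h3] at h1
    simpa using h1.unique h2
  have d1 := D 1 0 (- x 1)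
  have d2 := D 0 1 (x 0)
  have hs := Real.sq_sqrt hnn
  have hp := Real.sqrt_pos.2 hr'
  have q1 : gradient W1 x 0 - x 1 * gradient W1 x 2 =
      gradient W1 x 0 * 1 + gradient W1 x 1 * 0 + gradient W1 x 2 * (- x 1) := by ring
  have q2 : gradient W1 x 1 + x 0 * gradient W1 x 2 =
      gradient W1 x 0 * 0 + gradient W1 x 1 * 1 + gradient W1 x 2 * x 0 := by ring
  rw [q1, q2, d1, d2]
  have key : ∀ r s σ z : ℝ, 0 < r → r ^ 2 = x 0 ^ 2 + x 1 ^ 2 → σ ^ 2 = 1 → z = σ * s →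
    (2 * (r - s) * ((x 0 * 1 + x 1 * 0) / r - σ * (-x 1)) + 2 * z * (-x 1)) ^ 2 +
    (2 * (r - s) * ((x 0 * 0 + x 1 * 1) / r - σ * x 0) + 2 * z * x 0) ^ 2 =
    4 * ((r - s) ^ 2 + (r - 2 * s) ^ 2 * (x 0 ^ 2 + x 1 ^ 2)) := by
    intro r s σ z hr0 hr2 hσ hzs
    have : (2 * (r - s) * ((x 0 * 1 + x 1 * 0) / r - σ * (-x 1)) + 2 * z * (-x 1)) ^ 2 +
      (2 * (r - s) * ((x 0 * 0 + x 1 * 1) / r - σ * x 0) + 2 * z * x 0) ^ 2 =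
      4 * (r - s) ^ 2 * ((x 0 ^ 2 + x 1 ^ 2) / r ^ 2) +
      4 * σ ^ 2 * (r - 2 * s) ^ 2 * (x 0 ^ 2 + x 1 ^ 2) := by
      rw [hzs]; field_simp; ring
    rw [this, ← hr2, hσ, div_self (by positivity)]; ring
  apply key _ _ _ _ hp hs
  · rcases lt_or_gt_of_ne hz with h | h
    · simp [sign_neg h]
    · simp [sign_pos h]
  · exact (sign_mul_abs (x 2)).symm

lemma limgrad_identity (W1 : Euc 3 → ℝ)
    (hW1 : ∀ x : Euc 3, W1 x =
      (Real.sqrt (x 0 ^ 2 + x 1 ^ 2) - |x 2|) ^ 2 + (x 2) ^ 2)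
    (x : Euc 3) (hx : x ≠ 0) (p : Euc 3) (hp : p ∈ limitingGradients W1 x) :
    (p 0 - x 1 * p 2) ^ 2 + (p 1 + x 0 * p 2) ^ 2 =
    4 * ((Real.sqrt (x 0 ^ 2 + x 1 ^ 2) - |x 2|) ^ 2 +
      (Real.sqrt (x 0 ^ 2 + x 1 ^ 2) - 2 * |x 2|) ^ 2 * (x 0 ^ 2 + x 1 ^ 2)) := by
  obtain ⟨xk, hk, hxk, hgk⟩ := hp
  have c1 : Continuous (fun q : Euc 3 × Euc 3 =>
    (q.2 0 - q.1 1 * q.2 2) ^ 2 + (q.2 1 + q.1 0 * q.2 2) ^ 2) := by fun_prop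
  have c2 : Continuous (fun x : Euc 3 => 4 * ((Real.sqrt (x 0 ^ 2 + x 1 ^ 2) - |x 2|) ^ 2 +
      (Real.sqrt (x 0 ^ 2 + x 1 ^ 2) - 2 * |x 2|) ^ 2 * (x 0 ^ 2 + x 1 ^ 2))) := by fun_prop
  have t1 := (c1.tendsto (x, p)).comp (hxk.prodMk_nhds hgk)
  have t2 := (c2.tendsto x).comp hxk
  refine tendsto_nhds_unique_of_eventuallyEq t1 t2 ?_
  filter_upwards [hxk.eventually_ne hx] with k hk0
  exact grad_identity W1 hW1 (xk k) hk0 (hk k).1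

lemma V_lower (r s : ℝ) :
    min (((r - s) ^ 2 + s ^ 2)) (((r - s) ^ 2 + s ^ 2) ^ 2) ≤
      4 * ((r - s) ^ 2 + (r - 2 * s) ^ 2 * r ^ 2) := by
  have e : (r - 2 * s) ^ 2 * r ^ 2 = ((r - s) ^ 2 + s ^ 2 - 2 * (r - s) ^ 2) ^ 2 := by ring
  rw [e]
  have hA := sq_nonneg (r - s)
  have hB := sq_nonneg s
  generalize (r - s) ^ 2 = A at *
  generalize s ^ 2 = B at *
  rcases le_total A ((A + B) / 4) with h | h
  · refine (min_le_right _ _).trans ?_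
    nlinarith [mul_nonneg (show 0 ≤ (A + B) / 2 - 2 * A by linarith)
      (show 0 ≤ (A + B) + (A + B) / 2 - 2 * A by linarith)]
  · refine (min_le_left _ _).trans ?_
    nlinarith [sq_nonneg (A + B - 2 * A)]

/-- Section 5: for the nonholonomic integrator with a Lagrangian bounded by
`C√V`, the function `W₁` is a `p₀`-MRF for every `p₀ ∈ (0, 1/C)`. -/
theorem nonholonomic_integrator_W1_is_MRF
    (U : Set (Euc 2)) (hU : U = Metric.closedBall 0 1)
    (f : Euc 3 → Euc 2 → Euc 3)
    (hf : ∀ x u, f x u =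
      (WithLp.equiv 2 (Fin 3 → ℝ)).symm ![u 0, u 1, x 0 * u 1 - x 1 * u 0])
    (l : Euc 3 → Euc 2 → ℝ) (Cst p0 : ℝ)
    (V W1 : Euc 3 → ℝ)
    (hV : ∀ x : Euc 3, V x =
      (Real.sqrt (x 0 ^ 2 + x 1 ^ 2) - |x 2|) ^ 2 +
      (Real.sqrt (x 0 ^ 2 + x 1 ^ 2) - 2 * |x 2|) ^ 2 * (x 0 ^ 2 + x 1 ^ 2))
    (hW1 : ∀ x : Euc 3, W1 x =
      (Real.sqrt (x 0 ^ 2 + x 1 ^ 2) - |x 2|) ^ 2 + (x 2) ^ 2)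
    (hlcont : ContinuousOn (fun q : Euc 3 × Euc 2 => l q.1 q.2)
      ({(0 : Euc 3)}ᶜ ×ˢ U))
    (hlbound : ∀ x : Euc 3, ∀ u ∈ U, x ≠ 0 →
      0 ≤ l x u ∧ l x u ≤ Cst * Real.sqrt (V x))
    (hC : 0 < Cst) (hp0 : 0 < p0) (hp0C : p0 < 1 / Cst) :
    (∃ γ : ℝ → ℝ, IsMRF {(0 : Euc 3)} U f l p0 W1 γ) ∧
    (ContinuousOn W1 (closure ({(0 : Euc 3)}ᶜ)) ∧
      LocSemiconcaveOn {(0 : Euc 3)} W1 ∧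
      PosDefOn {(0 : Euc 3)} W1 ∧ ProperOn {(0 : Euc 3)} W1) ∧
    ∀ x : Euc 3, x ≠ 0 → ∀ p ∈ limitingGradients W1 x,
      Ham U f l p0 x p ≤ -(1 - p0 * Cst) * Real.sqrt (V x) := by
  have hkpos : 0 < 1 - p0 * Cst := by
    rw [lt_div_iff₀ hC] at hp0C; linarith
  have hcont : Continuous W1 := by
    rw [show W1 = _ from funext hW1]; fun_prop
  have hnn : ∀ x, 0 ≤ W1 x := fun x => by rw [hW1]; positivity
  have hlow : ∀ x, ‖x‖ ^ 2 ≤ 3 * W1 x := fun x => by rw [hW1]; exact W1_lower x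
  have hsc : LocSemiconcaveOn {(0 : Euc 3)} W1 := by
    intro S _ _
    refine ⟨2, by norm_num, fun x y _ => ?_⟩
    have hm : ∀ i, (midpoint ℝ x y) i = (x i + y i) / 2 := by
      intro i
      rw [midpoint_eq_smul_add]
      simp; ring
    rw [hW1, hW1, hW1, euc3_norm_sq, hm, hm, hm]
    simpa using semiconc_aux (x 0) (x 1) (y 0) (y 1) (x 2) (y 2)
  have hpd : PosDefOn {(0 : Euc 3)} W1 := by
    refine ⟨fun x hx => ?_, fun x hx => ?_⟩
    · have := norm_pos_iff.2 (show x ≠ 0 from hx)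
      have := hlow x
      have : 0 < ‖x‖ ^ 2 := by positivity
      linarith
    · have hx0 : x ∈ closure {(0 : Euc 3)} := frontier_subset_closure hx
      rw [closure_singleton] at hx0
      rw [Set.mem_singleton_iff.1 hx0, hW1]; simp
  have hprop : ProperOn {(0 : Euc 3)} W1 := by
    intro Kc hK _
    obtain ⟨M, hM⟩ := hK.bddAbove
    refine Metric.isCompact_of_isClosed_isBounded
      (isClosed_closure.inter (hK.isClosed.preimage hcont)) ?_
    refine (Metric.isBounded_closedBall (x := (0 : Euc 3)) (r := Real.sqrt (3 * M))).subset ?_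
    rintro x ⟨_, hx⟩
    rw [mem_closedBall_zero_iff]
    apply Real.le_sqrt_of_sq_le
    have := hM hx
    linarith [hlow x]
  have hham : ∀ x : Euc 3, x ≠ 0 → ∀ p ∈ limitingGradients W1 x,
      Ham U f l p0 x p ≤ -(1 - p0 * Cst) * Real.sqrt (V x) := by
    intro x hx p hp
    have hid := limgrad_identity W1 hW1 x hx p hp
    rw [← hV] at hid
    have hin : ∀ u : Euc 2, ⟪p, f x u⟫ =
        (p 0 - x 1 * p 2) * u 0 + (p 1 + x 0 * p 2) * u 1 := by
      intro u
      rw [hf, euc3_inner]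
      simp; ring
    generalize p 0 - x 1 * p 2 = q1 at *
    generalize p 1 + x 0 * p 2 = q2 at *
    have hV0 : 0 ≤ V x := by rw [hV]; positivity
    have hs0 := Real.sqrt_nonneg (V x)
    have hsq := Real.sq_sqrt hV0
    generalize hvs : Real.sqrt (V x) = v at *
    have hmem : ∀ u : Euc 2, u ∈ U ↔ u 0 ^ 2 + u 1 ^ 2 ≤ 1 := by
      intro u
      rw [hU, mem_closedBall_zero_iff, ← euc2_norm_sq, sq_le_one_iff₀ (norm_nonneg u)]
    have hbdd : BddBelow ((fun u => ⟪p, f x u⟫ + p0 * l x u) '' U) := by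
      refine ⟨-(2 * v), ?_⟩
      rintro _ ⟨u, hu, rfl⟩
      have h1 := (hlbound x u hu hx).1
      have h2 : 0 ≤ p0 * l x u := by positivity
      have hu' := (hmem u).1 hu
      have h3 : -(2 * v) ≤ q1 * u 0 + q2 * u 1 := by
        apply neg_le_of_abs_le
        apply abs_le_of_sq_le_sq _ (by positivity)
        nlinarith [sq_nonneg (q1 * u 1 - q2 * u 0), sq_nonneg v,
          mul_nonneg (sq_nonneg v) (sub_nonneg.2 hu')]
      simp only [hin]
      linarith
    have hex : ∃ u : Euc 2, u ∈ U ∧ q1 * u 0 + q2 * u 1 = -(2 * v) := by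
      rcases hs0.eq_or_lt with h | h
      · refine ⟨0, (hmem 0).2 (by simp), ?_⟩
        simp [← h]
      · refine ⟨!₂[-q1 / (2 * v), -q2 / (2 * v)], (hmem _).2 ?_, ?_⟩
        · simp
          rw [div_pow, div_pow, ← add_div, div_le_one (by positivity)]
          nlinarith
        · simp
          field_simp
          nlinarith
    obtain ⟨u, hu, hval⟩ := hex
    have h1 : Ham U f l p0 x p ≤ ⟪p, f x u⟫ + p0 * l x u := csInf_le hbdd ⟨u, hu, rfl⟩
    rw [hin, hval] at h1
    have h2 := (hlbound x u hu hx).2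
    rw [hvs] at h2
    nlinarith [mul_le_mul_of_nonneg_left h2 hp0.le]
  refine ⟨⟨fun t => (1 - p0 * Cst) * (min (Real.sqrt t) t / 2), hcont.continuousOn,
    fun x _ => hnn x, hsc, hpd, hprop, ⟨?_, ?_, ?_⟩, ?_⟩,
    ⟨hcont.continuousOn, hsc, hpd, hprop⟩, hham⟩
  · apply Continuous.continuousOn; fun_prop
  · intro a ha b _ hab
    have ha' : 0 < a := ha
    have hlt : min (Real.sqrt a) a < min (Real.sqrt b) b :=
      lt_min ((min_le_left _ _).trans_lt (Real.sqrt_lt_sqrt ha'.le hab))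
        ((min_le_right _ _).trans_lt hab)
    simp only
    apply mul_lt_mul_of_pos_left _ hkpos
    linarith
  · intro r hr
    have : 0 < min (Real.sqrt r) r := lt_min (Real.sqrt_pos.2 hr) hr
    positivity
  · intro x hx p hp
    refine (hham x hx p hp).trans ?_
    have hle : min (Real.sqrt (W1 x)) (W1 x) / 2 ≤ Real.sqrt (V x) := by
      apply Real.le_sqrt_of_sq_le
      have hl := V_lower (Real.sqrt (x 0 ^ 2 + x 1 ^ 2)) |x 2|
      rw [Real.sq_sqrt (by positivity), ← hV, sq_abs (x 2), ← hW1] at hl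
      have h0 : 0 ≤ min (Real.sqrt (W1 x)) (W1 x) := le_min (Real.sqrt_nonneg _) (hnn x)
      have hm : min (Real.sqrt (W1 x)) (W1 x) ^ 2 ≤ min (W1 x) (W1 x ^ 2) := by
        apply le_min
        · calc _ ≤ Real.sqrt (W1 x) ^ 2 := pow_le_pow_left₀ h0 (min_le_left _ _) 2
            _ = _ := Real.sq_sqrt (hnn x)
        · exact pow_le_pow_left₀ h0 (min_le_right _ _) 2
      rw [div_pow]
      linarith
    have := mul_le_mul_of_nonneg_left hle hkpos.le
    simp only
    linarith
end
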